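/- Let (X_t : t ∈ ℝ) be a zero-mean stationary Gaussian process with continuous paths and covariance kernel R(t) = ∫ e^{itx} μ(dx), where μ is a finite non-null symmetric measure on ℝ with μ([x,∞)) > 0 for all x > 0 and μ([x,∞)) regularly varying with index −α, 0 < α < 2. Let δ_u = (h(u^{−2}))^{−1}. Then, conditionally on [X_0 > u], as u → ∞, the process (u(X_{tδ_u} − u) : t ∈ ℝ) converges weakly on C(ℝ), equipped with the topology of uniform convergence on compact sets, to (Y_t : t ∈ ℝ), where Y_t = √(2C_α) B(t) + R(0) T* − (C_α/R(0)) |t|^α, B is a fractional Brownian motion with Hurst index α/2, T* is standard exponential independent of B, and C_α = π/(Γ(α) sin(πα/2)). -/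

import Mathlib

open MeasureTheory ProbabilityTheory Filter

/-- A real-valued stochastic process is a (zero-mean) Gaussian process if every finite
linear combination of its values has a centered Gaussian distribution. -/
def IsZeroMeanGaussianProcess {Ω : Type*} [MeasurableSpace Ω] (P : Measure Ω)
    (X : ℝ → Ω → ℝ) : Prop :=
  (∀ t, Measurable (X t)) ∧
  ∀ (n : ℕ) (t : Fin n → ℝ) (c : Fin n → ℝ),
    ∃ v : NNReal, P.map (fun ω => ∑ i, c i * X (t i) ω) = gaussianReal 0 v

section SineIntegral

open Real Set

lemma integrable_and_integral_rpow_div_one_add_sq {α : ℝ} (h0 : 0 < α) (h2 : α < 2) :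
    IntegrableOn (fun s : ℝ => s ^ (α - 1) / (1 + s ^ 2)) (Ioi 0) ∧
      ∫ s in Ioi (0 : ℝ), s ^ (α - 1) / (1 + s ^ 2) = π / (2 * sin (π * α / 2)) := by
  set f : ℝ × ℝ → ℝ := fun p => p.2 ^ (α - 1) * (exp (-p.1) * exp (-p.1 * p.2 ^ (2 : ℝ)))
  have hsec : ∀ w ∈ Ioi (0 : ℝ), IntegrableOn (fun s => f (w, s)) (Ioi 0) := by
    intro w hw
    have := (integrableOn_rpow_mul_exp_neg_mul_rpow (p := 2) (s := α - 1) (b := w)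
      (by linarith) (by norm_num) hw).const_mul (exp (-w))
    refine this.congr (Eventually.of_forall fun s => ?_)
    simp only [f]; ring
  have hval : ∀ w ∈ Ioi (0 : ℝ), ∫ s in Ioi (0 : ℝ), f (w, s) =
      (exp (-w) * w ^ ((1 - α / 2) - 1)) * (Gamma (α / 2) / 2) := by
    intro w hw
    have : ∀ s, f (w, s) = exp (-w) * (s ^ (α - 1) * exp (-w * s ^ (2 : ℝ))) := by
      intro s; simp only [f]; ring
    simp_rw [this, integral_const_mul,
      integral_rpow_mul_exp_neg_mul_rpow (p := 2) (q := α - 1) (b := w) (by norm_num)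
        (by linarith) hw]
    have e1 : -(α - 1 + 1) / 2 = 1 - α / 2 - 1 := by ring
    have e2 : (α - 1 + 1) / 2 = α / 2 := by ring
    rw [e1, e2]; ring
  have hmeas : Measurable f := by fun_prop
  have hinteg : Integrable f ((volume.restrict (Ioi 0)).prod (volume.restrict (Ioi 0))) := by
    rw [integrable_prod_iff hmeas.aestronglyMeasurable]
    refine ⟨(ae_restrict_iff' measurableSet_Ioi).2 (Eventually.of_forall hsec), ?_⟩
    have hG := (Real.GammaIntegral_convergent (s := 1 - α / 2) (by linarith)).mul_const
      (Gamma (α / 2) / 2)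
    refine Integrable.congr hG ?_
    refine (ae_restrict_iff' measurableSet_Ioi).2 (Eventually.of_forall fun w hw => ?_)
    beta_reduce
    rw [← hval w hw]
    refine setIntegral_congr_fun measurableSet_Ioi fun s hs => ?_
    have : 0 ≤ f (w, s) := by
      have : 0 ≤ s := le_of_lt hs
      simp only [f]; positivity
    simp [abs_of_nonneg this]
  have hinner : ∀ s ∈ Ioi (0 : ℝ), ∫ w in Ioi (0 : ℝ), f (w, s) = s ^ (α - 1) / (1 + s ^ 2) := by
    intro s hs
    have : ∀ w, f (w, s) = s ^ (α - 1) * exp (-(1 + s ^ 2) * w) := by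
      intro w; simp only [f]; rw [← exp_add]; congr 2; norm_num; ring
    simp_rw [this, integral_const_mul]
    rw [integral_exp_mul_Ioi (by nlinarith [sq_nonneg s])]
    have : 1 + s ^ 2 ≠ 0 := by positivity
    simp only [mul_zero, exp_zero]
    rw [neg_div_neg_eq]; ring
  refine ⟨?_, ?_⟩
  · refine hinteg.integral_prod_right.congr ?_
    exact (ae_restrict_iff' measurableSet_Ioi).2 (Eventually.of_forall hinner)
  · rw [← setIntegral_congr_fun measurableSet_Ioi hinner,
      integral_integral_swap (f := fun s w => f (w, s)) hinteg.swap,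
      setIntegral_congr_fun measurableSet_Ioi hval, integral_mul_const,
      ← Gamma_eq_integral (by linarith)]
    have := Real.Gamma_mul_Gamma_one_sub (α / 2)
    rw [show π * α / 2 = π * (α / 2) by ring, mul_comm 2, ← div_div, ← this]; ring

lemma integral_sin_mul_exp_neg_mul (s : ℝ) (k : ℕ) :
    ∫ y in Ioc (0 : ℝ) (k * (2 * π)), sin y * exp (-(s * y)) =
      (1 - exp (-(s * (k * (2 * π))))) / (1 + s ^ 2) := by
  have hk : (0 : ℝ) ≤ k * (2 * π) := by positivity
  have hs : 1 + s ^ 2 ≠ 0 := by positivity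
  rw [← intervalIntegral.integral_of_le hk]
  have hd : ∀ y ∈ uIcc (0 : ℝ) (k * (2 * π)),
      HasDerivAt (fun y => -(exp (-(s * y)) * (cos y + s * sin y)) / (1 + s ^ 2))
        (sin y * exp (-(s * y))) y := by
    intro y _
    have h1 : HasDerivAt (fun y => exp (-(s * y))) (exp (-(s * y)) * (-(s * 1))) y :=
      (((hasDerivAt_id y).const_mul s).neg).exp
    have h2 : HasDerivAt (fun y => cos y + s * sin y) (-sin y + s * cos y) y :=
      (hasDerivAt_cos y).add ((hasDerivAt_sin y).const_mul s)
    convert! ((h1.mul h2).neg.div_const (1 + s ^ 2)) using 1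
    field_simp
    ring
  rw [intervalIntegral.integral_eq_sub_of_hasDerivAt hd
    (Continuous.intervalIntegrable (by fun_prop) _ _)]
  have hsin : sin (k * (2 * π)) = 0 := by
    have := sin_nat_mul_pi (2 * k)
    push_cast at this
    rw [← this]; ring_nf
  simp only [cos_nat_mul_two_pi, hsin, mul_zero, neg_zero, exp_zero, cos_zero,
    sin_zero, add_zero]
  field_simp
  ring

lemma tendsto_integral_sin_mul_rpow {α : ℝ} (h0 : 0 < α) (h2 : α < 2) :
    Tendsto (fun k : ℕ => ∫ y in Ioc (0 : ℝ) (k * (2 * π)), sin y * y ^ (-α)) atTop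
      (nhds (π / (Gamma α * sin (π * α / 2)) / 2)) := by
  have hΓ : 0 < Gamma α := Gamma_pos_of_pos h0
  obtain ⟨hinteg0, hval0⟩ := integrable_and_integral_rpow_div_one_add_sq h0 h2
  have key : ∀ k : ℕ, ∫ y in Ioc (0 : ℝ) (k * (2 * π)), sin y * y ^ (-α) =
      (Gamma α)⁻¹ * ∫ s in Ioi (0 : ℝ),
        s ^ (α - 1) / (1 + s ^ 2) * (1 - exp (-(s * (k * (2 * π))))) := by
    intro k
    set A : ℝ := k * (2 * π)
    set f : ℝ × ℝ → ℝ := fun p => sin p.1 * (p.2 ^ (α - 1) * exp (-(p.1 * p.2)))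
    have hmeas : Measurable f := by fun_prop
    have hsec : ∀ y ∈ Ioc 0 A, IntegrableOn (fun s => f (y, s)) (Ioi 0) := by
      intro y hy
      have := (integrableOn_rpow_mul_exp_neg_mul_rpow (p := 1) (s := α - 1) (b := y)
        (by linarith) (by norm_num) hy.1).const_mul (sin y)
      refine this.congr (Eventually.of_forall fun s => ?_)
      simp [f]
    have hin : ∀ y : ℝ, 0 < y → ∫ s in Ioi (0 : ℝ), s ^ (α - 1) * exp (-(y * s)) =
        y ^ (-α) * Gamma α := by
      intro y hy
      rw [integral_rpow_mul_exp_neg_mul_Ioi h0 hy, one_div, inv_rpow hy.le, rpow_neg hy.le]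
    have hinteg : Integrable f ((volume.restrict (Ioc 0 A)).prod (volume.restrict (Ioi 0))) := by
      rw [integrable_prod_iff hmeas.aestronglyMeasurable]
      refine ⟨(ae_restrict_iff' measurableSet_Ioc).2 (Eventually.of_forall hsec), ?_⟩
      have hb : IntegrableOn (fun y : ℝ => y ^ (1 - α) * Gamma α) (Ioc 0 A) := by
        have := (intervalIntegral.intervalIntegrable_rpow' (r := 1 - α) (a := 0) (b := A)
          (by linarith)).1
        exact this.mul_const _
      refine Integrable.mono' hb ?_ ?_
      · exact (hmeas.aestronglyMeasurable (μ :=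
          (volume.restrict (Ioc 0 A)).prod (volume.restrict (Ioi 0)))).norm.integral_prod_right'
      · refine (ae_restrict_iff' measurableSet_Ioc).2 (Eventually.of_forall fun y hy => ?_)
        have hn : ∀ s ∈ Ioi (0 : ℝ), ‖f (y, s)‖ = |sin y| * (s ^ (α - 1) * exp (-(y * s))) := by
          intro s hs
          have hs : (0 : ℝ) < s := hs
          simp only [f, norm_mul, Real.norm_eq_abs, abs_exp, abs_of_pos (rpow_pos_of_pos hs _)]
        rw [setIntegral_congr_fun measurableSet_Ioi hn, integral_const_mul, hin y hy.1,
          Real.norm_eq_abs, abs_of_nonneg (by have := hy.1; positivity), ← mul_assoc]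
        refine mul_le_mul_of_nonneg_right ?_ hΓ.le
        rw [sub_eq_add_neg, rpow_add hy.1, rpow_one]
        refine mul_le_mul_of_nonneg_right ?_ (by have := hy.1; positivity)
        exact (abs_sin_le_abs).trans (abs_of_pos hy.1).le
    have h1 : ∀ y ∈ Ioc (0 : ℝ) A, ∫ s in Ioi (0 : ℝ), f (y, s) =
        sin y * y ^ (-α) * Gamma α := by
      intro y hy
      simp only [f]
      rw [integral_const_mul, hin y hy.1]; ring
    have h3 : ∀ s ∈ Ioi (0 : ℝ), ∫ y in Ioc (0 : ℝ) A, f (y, s) =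
        s ^ (α - 1) / (1 + s ^ 2) * (1 - exp (-(s * A))) := by
      intro s _
      have : ∀ y, f (y, s) = s ^ (α - 1) * (sin y * exp (-(s * y))) := by
        intro y; simp only [f]; rw [mul_comm y s]; ring
      simp_rw [this, integral_const_mul, A, integral_sin_mul_exp_neg_mul]; ring
    rw [← setIntegral_congr_fun measurableSet_Ioi h3,
      integral_integral_swap (f := fun s y => f (y, s)) hinteg.swap,
      setIntegral_congr_fun measurableSet_Ioc h1, integral_mul_const]
    field_simp
  simp_rw [key]
  have hlim : Tendsto (fun k : ℕ => ∫ s in Ioi (0 : ℝ),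
        s ^ (α - 1) / (1 + s ^ 2) * (1 - exp (-(s * (k * (2 * π)))))) atTop
      (nhds (∫ s in Ioi (0 : ℝ), s ^ (α - 1) / (1 + s ^ 2))) := by
    refine tendsto_integral_of_dominated_convergence
      (fun s => s ^ (α - 1) / (1 + s ^ 2)) (fun k => ?_) hinteg0 (fun k => ?_) ?_
    · exact Measurable.aestronglyMeasurable (by fun_prop)
    · refine (ae_restrict_iff' measurableSet_Ioi).2 (Eventually.of_forall fun s hs => ?_)
      have hs : (0 : ℝ) < s := hs
      have hp : 0 ≤ s ^ (α - 1) / (1 + s ^ 2) := by positivity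
      have he : exp (-(s * (k * (2 * π)))) ≤ 1 := by
        rw [exp_le_one_iff]; have : 0 ≤ s * (k * (2 * π)) := by positivity
        linarith
      rw [Real.norm_eq_abs, abs_of_nonneg (mul_nonneg hp (by linarith))]
      exact mul_le_of_le_one_right hp (by linarith [exp_pos (-(s * (k * (2 * π))))])
    · refine (ae_restrict_iff' measurableSet_Ioi).2 (Eventually.of_forall fun s hs => ?_)
      have hs : (0 : ℝ) < s := hs
      have h1 : Tendsto (fun k : ℕ => exp (-(s * (k * (2 * π))))) atTop (nhds 0) := by
        refine tendsto_exp_neg_atTop_nhds_zero.comp ?_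
        refine Tendsto.const_mul_atTop hs ?_
        exact tendsto_natCast_atTop_atTop.atTop_mul_const (by positivity)
      simpa using (h1.const_sub 1).const_mul (s ^ (α - 1) / (1 + s ^ 2))
  have := hlim.const_mul (Gamma α)⁻¹
  rw [hval0] at this
  convert this using 2
  have hs : sin (π * α / 2) ≠ 0 :=
    (sin_pos_of_pos_of_lt_pi (by positivity) (by nlinarith [pi_pos])).ne'
  field_simp

end SineIntegral

section RegularVariation

open Real Set

variable {G : ℝ → ℝ} {α β : ℝ}

lemma exists_le_mul_rpow_neg_of_le (hG : Antitone G)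
    (hhalf : ∃ x₀ > 0, ∀ x ≥ x₀, G (x / 2) ≤ 2 ^ β * G x)
    (hpos : ∀ x > 0, 0 < G x) (hβ : 0 < β) :
    ∃ x₀ > 0, ∀ x ≥ x₀, ∀ y > 0, y ≤ 1 → x₀ ≤ x * y → G (x * y) ≤ 2 ^ β * y ^ (-β) * G x := by
  obtain ⟨x₀, hx₀, h⟩ := hhalf
  refine ⟨x₀, hx₀, fun x hx y hy hy1 hxy => ?_⟩
  have hxpos : 0 < x := hx₀.trans_le hx
  obtain ⟨n, hn1, hn2⟩ := exists_nat_pow_near_of_lt_one hy hy1 (by norm_num : (0 : ℝ) < 1 / 2)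
    (by norm_num)
  have iter : ∀ i ≤ n + 1, G (x * (1 / 2) ^ i) ≤ (2 ^ β) ^ i * G x := by
    intro i hi
    induction i with
    | zero => simp
    | succ i ih =>
      have hxi : x₀ ≤ x * (1 / 2) ^ i := by
        refine hxy.trans (mul_le_mul_of_nonneg_left (hn2.trans ?_) hxpos.le)
        exact pow_le_pow_of_le_one (by norm_num) (by norm_num) (by omega)
      calc G (x * (1 / 2) ^ (i + 1)) = G (x * (1 / 2) ^ i / 2) := by congr 1; ring
        _ ≤ 2 ^ β * G (x * (1 / 2) ^ i) := h _ hxi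
        _ ≤ 2 ^ β * ((2 ^ β) ^ i * G x) :=
            mul_le_mul_of_nonneg_left (ih (by omega)) (by positivity)
        _ = (2 ^ β) ^ (i + 1) * G x := by ring
  calc G (x * y) ≤ G (x * (1 / 2) ^ (n + 1)) := hG (mul_le_mul_of_nonneg_left hn1.le hxpos.le)
    _ ≤ (2 ^ β) ^ (n + 1) * G x := iter _ le_rfl
    _ ≤ 2 ^ β * y ^ (-β) * G x := by
      refine mul_le_mul_of_nonneg_right ?_ (hpos x hxpos).le
      rw [pow_succ, mul_comm]
      refine mul_le_mul_of_nonneg_left ?_ (by positivity)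
      have : ((2 : ℝ) ^ β) ^ n = ((1 / 2 : ℝ) ^ n) ^ (-β) := by
        rw [← rpow_natCast, ← rpow_natCast, ← rpow_mul (by norm_num), ← rpow_mul (by norm_num),
          one_div, inv_rpow (by norm_num), ← rpow_neg (by norm_num)]
        congr 1; ring
      rw [this]
      exact rpow_le_rpow_of_nonpos hy hn2 (by linarith)

/-- A Potter-type bound. -/
lemma exists_forall_div_le_mul_rpow_neg (hG : Antitone G) (hpos : ∀ x > 0, 0 < G x)
    {M : ℝ} (hM : ∀ x, G x ≤ M)
    (hrv : ∀ c > 0, Tendsto (fun x => G (c * x) / G x) atTop (nhds (c ^ (-α))))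
    (hα : 0 < α) (hαβ : α < β) :
    ∃ C, ∀ᶠ x in atTop, ∀ y > 0, y ≤ 1 → G (x * y) / G x ≤ C * y ^ (-β) := by
  have hβ : 0 < β := hα.trans hαβ
  have h2 : ((1 / 2 : ℝ) ^ (-α)) < 2 ^ β := by
    rw [one_div, inv_rpow (by norm_num), ← rpow_neg (by norm_num), neg_neg]
    exact rpow_lt_rpow_of_exponent_lt (by norm_num) hαβ
  have hhalf : ∃ x₀ > 0, ∀ x ≥ x₀, G (x / 2) ≤ 2 ^ β * G x := by
    obtain ⟨x₀, hx₀⟩ := eventually_atTop.1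
      (((hrv (1 / 2) (by norm_num)).eventually_lt_const h2).and (eventually_gt_atTop 0))
    refine ⟨max x₀ 1, by positivity, fun x hx => ?_⟩
    obtain ⟨h3, h4⟩ := hx₀ x ((le_max_left _ _).trans hx)
    rw [div_lt_iff₀ (hpos x h4)] at h3
    rw [div_eq_inv_mul, ← one_div]
    exact h3.le
  obtain ⟨x₀, hx₀, h⟩ := exists_le_mul_rpow_neg_of_le hG hhalf hpos hβ
  have hM0 : 0 < M := (hpos x₀ hx₀).trans_le (hM x₀)
  refine ⟨2 ^ β * max 1 (M / G x₀), ?_⟩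
  filter_upwards [eventually_ge_atTop x₀] with x hx y hy hy1
  have hxpos : 0 < x := hx₀.trans_le hx
  rw [div_le_iff₀ (hpos x hxpos)]
  have hnn : 0 ≤ y ^ (-β) * G x := mul_nonneg (by positivity) (hpos x hxpos).le
  rcases le_or_gt x₀ (x * y) with hxy | hxy
  · refine (h x hx y hy hy1 hxy).trans ?_
    have : (2 : ℝ) ^ β * 1 ≤ 2 ^ β * max 1 (M / G x₀) :=
      mul_le_mul_of_nonneg_left (le_max_left _ _) (by positivity)
    nlinarith
  · have h1 := h x hx (x₀ / x) (by positivity) ((div_le_one hxpos).2 hx)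
      (by rw [mul_div_cancel₀ _ hxpos.ne'])
    rw [mul_div_cancel₀ _ hxpos.ne'] at h1
    have h3 : (x₀ / x) ^ (-β) ≤ y ^ (-β) := by
      refine rpow_le_rpow_of_nonpos hy ?_ (by linarith)
      rw [le_div_iff₀ hxpos]; linarith
    have h4 : G x₀ ≤ 2 ^ β * (y ^ (-β) * G x) := by
      rw [← mul_assoc]
      refine h1.trans ?_
      refine mul_le_mul_of_nonneg_right ?_ (hpos x hxpos).le
      exact mul_le_mul_of_nonneg_left h3 (by positivity)
    calc G (x * y) ≤ M := hM _
      _ = M / G x₀ * G x₀ := by rw [div_mul_cancel₀ _ (hpos x₀ hx₀).ne']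
      _ ≤ max 1 (M / G x₀) * (2 ^ β * (y ^ (-β) * G x)) :=
        mul_le_mul (le_max_right _ _) h4 (hpos x₀ hx₀).le (by positivity)
      _ = _ := by ring

end RegularVariation

section CharacteristicExponent

open Real Set

variable {μ : Measure ℝ} [IsFiniteMeasure μ] {α : ℝ}

lemma antitone_measureReal_Ici : Antitone (fun x => μ.real (Ici x)) :=
  fun _ _ h => measureReal_mono (Ici_subset_Ici.2 h)

lemma setIntegral_one_sub_cos_eq {X : ℝ} (hX : 0 < X) (k : ℕ) :
    ∫ x in Ioc 0 (k * (2 * π) * X), (1 - cos (x / X)) ∂μ =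
      ∫ y in Ioc (0 : ℝ) (k * (2 * π)), sin y * μ.real (Ici (X * y)) := by
  set A : ℝ := k * (2 * π) with hA
  have hA0 : 0 ≤ A := by positivity
  set f : ℝ × ℝ → ℝ := fun p => {p : ℝ × ℝ | X * p.2 ≤ p.1}.indicator (fun p => sin p.2) p
  have hms : MeasurableSet {p : ℝ × ℝ | X * p.2 ≤ p.1} :=
    measurableSet_le (by fun_prop) (by fun_prop)
  have hmeas : Measurable f := (by fun_prop : Measurable fun p : ℝ × ℝ => sin p.2).indicator hms
  have hinteg : Integrable f ((μ.restrict (Ioi 0)).prod (volume.restrict (Ioc 0 A))) := by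
    refine Integrable.of_bound hmeas.aestronglyMeasurable 1 (Eventually.of_forall fun p => ?_)
    simp only [f, indicator]
    split_ifs
    · exact abs_sin_le_one _
    · simp
  have hx : ∀ x ∈ Ioi (0 : ℝ), ∫ y in Ioc 0 A, f (x, y) =
      (Ioc 0 (A * X)).indicator (fun x => 1 - cos (x / X)) x := by
    intro x hx
    have hx : 0 < x := hx
    have e1 : ∀ y, f (x, y) = (Iic (x / X)).indicator sin y := by
      intro y
      simp only [f, indicator, mem_ofPred_eq, mem_Iic, le_div_iff₀ hX, mul_comm]
    simp_rw [e1]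
    rw [setIntegral_indicator measurableSet_Iic, Ioc_inter_Iic,
      ← intervalIntegral.integral_of_le (le_min hA0 (by positivity)), integral_sin, cos_zero]
    rcases le_or_gt x (A * X) with h | h
    · have hmem : x ∈ Ioc 0 (A * X) := ⟨hx, h⟩
      rw [indicator_of_mem hmem, min_eq_right]
      rwa [div_le_iff₀ hX]
    · have hmem : x ∉ Ioc 0 (A * X) := fun h' => absurd h'.2 (not_le.2 h)
      rw [indicator_of_notMem hmem, min_eq_left, hA,
        cos_nat_mul_two_pi, sub_self]
      rw [le_div_iff₀ hX]; exact h.le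
  have hy : ∀ y ∈ Ioc (0 : ℝ) A, ∫ x in Ioi 0, f (x, y) ∂μ = sin y * μ.real (Ici (X * y)) := by
    intro y hy
    have e1 : ∀ x, f (x, y) = (Ici (X * y)).indicator (fun _ => sin y) x := by
      intro x
      simp only [f, indicator, mem_ofPred_eq, mem_Ici]
    have hsub : Ioi 0 ∩ Ici (X * y) = Ici (X * y) :=
      inter_eq_right.2 fun z hz => (mul_pos hX hy.1).trans_le hz
    simp_rw [e1]
    rw [setIntegral_indicator measurableSet_Ici, hsub, setIntegral_const, smul_eq_mul, mul_comm]
  have hsub : Ioi 0 ∩ Ioc 0 (A * X) = Ioc 0 (A * X) := inter_eq_right.2 fun z hz => hz.1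
  rw [← setIntegral_congr_fun measurableSet_Ioc hy,
    ← integral_integral_swap (f := fun x y => f (x, y)) hinteg,
    setIntegral_congr_fun measurableSet_Ioi hx, setIntegral_indicator measurableSet_Ioc, hsub]

lemma tendsto_integral_sin_mul_tail_div (h0 : 0 < α) (h2 : α < 2)
    (hpos : ∀ x > 0, 0 < μ.real (Ici x))
    (hrv : ∀ c > 0, Tendsto (fun x => μ.real (Ici (c * x)) / μ.real (Ici x)) atTop
      (nhds (c ^ (-α)))) (A : ℝ) :
    Tendsto (fun X => ∫ y in Ioc (0 : ℝ) A, sin y * (μ.real (Ici (X * y)) / μ.real (Ici X)))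
      atTop (nhds (∫ y in Ioc (0 : ℝ) A, sin y * y ^ (-α))) := by
  obtain ⟨β, hαβ, hβ2⟩ := exists_between h2
  obtain ⟨C, hC⟩ := exists_forall_div_le_mul_rpow_neg (antitone_measureReal_Ici (μ := μ)) hpos
    (fun x => measureReal_mono (subset_univ _)) hrv h0 hαβ
  refine tendsto_integral_filter_of_dominated_convergence (fun y => C * y ^ (1 - β) + 1)
    (Eventually.of_forall fun X => ?_) ?_ ?_ ?_
  · have : Measurable fun y => μ.real (Ici (X * y)) := by
      rcases le_total 0 X with h | h
      · exact Antitone.measurable fun a b hab => antitone_measureReal_Ici (μ := μ)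
          (mul_le_mul_of_nonneg_left hab h)
      · exact Monotone.measurable fun a b hab => antitone_measureReal_Ici (μ := μ)
          (mul_le_mul_of_nonpos_left hab h)
    exact Measurable.aestronglyMeasurable (by fun_prop)
  · filter_upwards [hC, eventually_gt_atTop 0] with X hCX hX
    refine (ae_restrict_iff' measurableSet_Ioc).2 (Eventually.of_forall fun y hy => ?_)
    have hy0 := hy.1
    have hq : 0 ≤ μ.real (Ici (X * y)) / μ.real (Ici X) := by positivity
    rw [norm_mul, Real.norm_eq_abs, Real.norm_eq_abs, abs_of_nonneg hq]
    have hC0 : 0 ≤ C := by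
      have := hCX 1 one_pos le_rfl
      simp only [mul_one, one_rpow, div_self (hpos X hX).ne'] at this
      linarith
    rcases le_or_gt y 1 with hy1 | hy1
    · calc |sin y| * (μ.real (Ici (X * y)) / μ.real (Ici X)) ≤ y * (C * y ^ (-β)) :=
            mul_le_mul (abs_sin_le_abs.trans (abs_of_pos hy0).le) (hCX y hy0 hy1) hq hy0.le
        _ = C * y ^ (1 - β) := by
            rw [sub_eq_add_neg, rpow_add hy0, rpow_one]; ring
        _ ≤ _ := by linarith
    · have : μ.real (Ici (X * y)) / μ.real (Ici X) ≤ 1 := by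
        rw [div_le_one (hpos X hX)]
        exact antitone_measureReal_Ici (le_mul_of_one_le_right hX.le hy1.le)
      have h3 : |sin y| * (μ.real (Ici (X * y)) / μ.real (Ici X)) ≤ 1 * 1 :=
        mul_le_mul (abs_sin_le_one y) this hq zero_le_one
      have : 0 ≤ C * y ^ (1 - β) := by positivity
      linarith
  · refine Integrable.add (Integrable.const_mul ?_ _) (integrable_const _)
    exact (intervalIntegral.intervalIntegrable_rpow' (r := 1 - β) (a := 0) (b := A)
          (by linarith)).1
  · refine (ae_restrict_iff' measurableSet_Ioc).2 (Eventually.of_forall fun y hy => ?_)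
    simp_rw [mul_comm _ y]
    exact (hrv y hy.1).const_mul _

/-- An Abelian theorem for the cosine transform of a measure with regularly varying tail. -/
lemma tendsto_integral_one_sub_cos_div (h0 : 0 < α) (h2 : α < 2)
    (hpos : ∀ x > 0, 0 < μ.real (Ici x))
    (hrv : ∀ c > 0, Tendsto (fun x => μ.real (Ici (c * x)) / μ.real (Ici x)) atTop
      (nhds (c ^ (-α)))) :
    Tendsto (fun X => (∫ x in Ioi 0, (1 - cos (x / X)) ∂μ) / μ.real (Ici X)) atTop
      (nhds (π / (Gamma α * sin (π * α / 2)) / 2)) := by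
  rw [Metric.tendsto_nhds]
  intro ε hε
  have hA : Tendsto (fun k : ℕ => 2 * ((k : ℝ) * (2 * π)) ^ (-α)) atTop (nhds (2 * 0)) := by
    refine Tendsto.const_mul _ ((tendsto_rpow_neg_atTop h0).comp ?_)
    exact tendsto_natCast_atTop_atTop.atTop_mul_const (by positivity)
  rw [mul_zero] at hA
  obtain ⟨k, hk1, hk2, hk0⟩ := ((hA.eventually_lt_const (show (0 : ℝ) < ε / 3 by positivity)).and
    (((Metric.tendsto_nhds.1 (tendsto_integral_sin_mul_rpow h0 h2)) (ε / 3) (by positivity)).and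
      (eventually_gt_atTop 0))).exists
  set A : ℝ := k * (2 * π) with hAdef
  have hApos : 0 < A := by positivity
  have t1 := ((hrv A hApos).const_mul 2).eventually_lt_const hk1
  have t2 := Metric.tendsto_nhds.1 (tendsto_integral_sin_mul_tail_div h0 h2 hpos hrv A)
    (ε / 3) (by positivity)
  filter_upwards [t1, t2, eventually_gt_atTop 0] with X h1 h3 hX
  have hGX := hpos X hX
  have hi : ∀ s, IntegrableOn (fun x => 1 - cos (x / X)) s μ := fun s =>
    Integrable.of_bound (by fun_prop) 2 (Eventually.of_forall fun x => by
      rw [Real.norm_eq_abs, abs_le]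
      constructor <;> linarith [cos_le_one (x / X), neg_one_le_cos (x / X)])
  have hsplit : ∫ x in Ioi 0, (1 - cos (x / X)) ∂μ =
      (∫ x in Ioc 0 (A * X), (1 - cos (x / X)) ∂μ) +
        ∫ x in Ioi (A * X), (1 - cos (x / X)) ∂μ := by
    rw [← setIntegral_union (Ioc_disjoint_Ioi le_rfl) measurableSet_Ioi (hi _) (hi _),
      Ioc_union_Ioi_eq_Ioi (by positivity)]
  have hmain : (∫ x in Ioc 0 (A * X), (1 - cos (x / X)) ∂μ) / μ.real (Ici X) =
      ∫ y in Ioc (0 : ℝ) A, sin y * (μ.real (Ici (X * y)) / μ.real (Ici X)) := by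
    rw [hAdef, setIntegral_one_sub_cos_eq hX, ← integral_div]
    simp_rw [mul_div_assoc]
  have hrem0 : 0 ≤ ∫ x in Ioi (A * X), (1 - cos (x / X)) ∂μ :=
    integral_nonneg fun x => by simpa using cos_le_one _
  have hrem : (∫ x in Ioi (A * X), (1 - cos (x / X)) ∂μ) ≤ 2 * μ.real (Ici (A * X)) := by
    calc _ ≤ ∫ x in Ioi (A * X), (2 : ℝ) ∂μ :=
          integral_mono (hi _) (integrable_const _) fun x => by
            linarith [neg_one_le_cos (x / X)]
      _ = 2 * μ.real (Ioi (A * X)) := by simp [mul_comm]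
      _ ≤ _ := by
          refine mul_le_mul_of_nonneg_left (measureReal_mono Ioi_subset_Ici_self) (by norm_num)
  have hrem2 : (∫ x in Ioi (A * X), (1 - cos (x / X)) ∂μ) / μ.real (Ici X) < ε / 3 := by
    refine lt_of_le_of_lt ?_ h1
    rw [← mul_div_assoc]
    exact div_le_div_of_nonneg_right hrem hGX.le
  have hrem3 := div_nonneg hrem0 hGX.le
  rw [hsplit, add_div, hmain]
  rw [Real.dist_eq] at *
  rw [abs_lt] at *
  constructor <;> linarith [h3.1, h3.2, hk2.1, hk2.2]

end CharacteristicExponent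

section Scaling

open Real Set

variable {G : ℝ → ℝ} {α : ℝ} {k : ℝ → ℝ}

lemma tendsto_sInf_le_rpow_neg_two (hG : Antitone G) (hpos : ∀ x > 0, 0 < G x)
    (hlim : Tendsto G atTop (nhds 0))
    (hk : ∀ u, k u = sInf {x : ℝ | 0 ≤ x ∧ G x ≤ u ^ (-2 : ℝ)}) :
    Tendsto k atTop atTop := by
  rw [tendsto_atTop]
  intro B
  have hy : Tendsto (fun u : ℝ => u ^ (-2 : ℝ)) atTop (nhds 0) :=
    tendsto_rpow_neg_atTop (by norm_num)
  have hB := hpos (max B 1) (by positivity)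
  filter_upwards [hy.eventually_lt_const hB, eventually_gt_atTop 0] with u hu hu0
  have hy0 : 0 < u ^ (-2 : ℝ) := by positivity
  obtain ⟨x, hx, hx0⟩ := ((hlim.eventually_lt_const hy0).and (eventually_ge_atTop 0)).exists
  rw [hk]
  refine le_csInf ⟨x, hx0, hx.le⟩ fun z hz => ?_
  by_contra! hlt
  exact absurd (hu.trans_le (hG (hlt.le.trans (le_max_left _ _)))) (not_lt.2 hz.2)

/-- The generalised inverse `k u` of a regularly varying tail `G` at level `u⁻²` satisfies
`u² G(c k(u)) → c ^ (-α)`. -/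
lemma tendsto_sq_mul_comp_sInf (hG : Antitone G) (hpos : ∀ x > 0, 0 < G x)
    (hlim : Tendsto G atTop (nhds 0))
    (hrv : ∀ c > 0, Tendsto (fun x => G (c * x) / G x) atTop (nhds (c ^ (-α))))
    (hk : ∀ u, k u = sInf {x : ℝ | 0 ≤ x ∧ G x ≤ u ^ (-2 : ℝ)}) {c : ℝ} (hc : 0 < c) :
    Tendsto (fun u => u ^ 2 * G (c * k u)) atTop (nhds (c ^ (-α))) := by
  have hkt := tendsto_sInf_le_rpow_neg_two hG hpos hlim hk
  have hsq : ∀ u : ℝ, 0 < u → u ^ 2 * u ^ (-2 : ℝ) = 1 := by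
    intro u hu
    rw [← rpow_natCast, ← rpow_add hu]; norm_num
  have hup : ∀ a > 1, ∀ᶠ u in atTop, u ^ 2 * G (a * k u) ≤ 1 := by
    intro a ha
    filter_upwards [hkt.eventually_gt_atTop 0, eventually_gt_atTop 0] with u hku hu
    have hy0 : 0 < u ^ (-2 : ℝ) := by positivity
    have hne : {x : ℝ | 0 ≤ x ∧ G x ≤ u ^ (-2 : ℝ)}.Nonempty := by
      obtain ⟨x, hx, hx0⟩ := ((hlim.eventually_lt_const hy0).and (eventually_ge_atTop 0)).exists
      exact ⟨x, hx0, hx.le⟩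
    have hlt : sInf {x : ℝ | 0 ≤ x ∧ G x ≤ u ^ (-2 : ℝ)} < a * k u := by
      rw [← hk]; nlinarith
    obtain ⟨x, hx, hxa⟩ := exists_lt_of_csInf_lt hne hlt
    rw [← hsq u hu]
    exact mul_le_mul_of_nonneg_left ((hG hxa.le).trans hx.2) (by positivity)
  have hdn : ∀ a > 0, a < 1 → ∀ᶠ u in atTop, 1 ≤ u ^ 2 * G (a * k u) := by
    intro a ha0 ha
    filter_upwards [hkt.eventually_gt_atTop 0, eventually_gt_atTop 0] with u hku hu
    rw [← hsq u hu]
    refine mul_le_mul_of_nonneg_left ?_ (by positivity)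
    by_contra! hlt
    have : k u ≤ a * k u := by
      conv_lhs => rw [hk]
      exact csInf_le ⟨0, fun x hx => hx.1⟩ ⟨by positivity, hlt.le⟩
    nlinarith
  have hratio : ∀ a > 0, Tendsto (fun u => G (c * k u) / G (a * k u)) atTop
      (nhds ((c / a) ^ (-α))) := by
    intro a ha
    have := (hrv (c / a) (by positivity)).comp (hkt.const_mul_atTop ha)
    refine this.congr fun u => ?_
    simp only [Function.comp]
    rw [← mul_assoc, div_mul_cancel₀ _ ha.ne']
  have hcont : Tendsto (fun a : ℝ => (c / a) ^ (-α)) (nhds 1) (nhds (c ^ (-α))) := by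
    have : ContinuousAt (fun a : ℝ => (c / a) ^ (-α)) 1 := by
      refine ContinuousAt.rpow_const (continuousAt_const.div continuousAt_id one_ne_zero)
        (Or.inl ?_)
      simpa using hc.ne'
    simpa [ContinuousAt] using this
  rw [tendsto_order]
  constructor
  · intro l hl
    have hlt : ∀ᶠ a in nhdsWithin (1 : ℝ) (Iio 1), a < 1 := eventually_mem_nhdsWithin
    have hgt : ∀ᶠ a in nhdsWithin (1 : ℝ) (Iio 1), 0 < a :=
      mem_nhdsWithin_of_mem_nhds (lt_mem_nhds one_pos)
    obtain ⟨a, ha1, ha2, ha0⟩ := (((hcont.mono_left nhdsWithin_le_nhds).eventually_const_lt hl).and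
      (hlt.and hgt)).exists
    filter_upwards [(hratio a ha0).eventually_const_lt ha1, hdn a ha0 ha2,
      hkt.eventually_gt_atTop 0] with u h1 h2 hku
    have hGa := hpos (a * k u) (by positivity)
    have hGc := hpos (c * k u) (by positivity)
    calc l < G (c * k u) / G (a * k u) := h1
      _ ≤ (u ^ 2 * G (a * k u)) * (G (c * k u) / G (a * k u)) :=
        le_mul_of_one_le_left (by positivity) h2
      _ = u ^ 2 * G (c * k u) := by rw [mul_assoc, mul_div_cancel₀ _ hGa.ne']
  · intro l hl
    have hgt : ∀ᶠ a in nhdsWithin (1 : ℝ) (Ioi 1), 1 < a := eventually_mem_nhdsWithin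
    obtain ⟨a, ha1, ha2⟩ := (((hcont.mono_left nhdsWithin_le_nhds).eventually_lt_const hl).and
      hgt).exists
    have ha0 : (0 : ℝ) < a := one_pos.trans ha2
    filter_upwards [(hratio a ha0).eventually_lt_const ha1, hup a ha2,
      hkt.eventually_gt_atTop 0] with u h1 h2 hku
    have hGa := hpos (a * k u) (by positivity)
    have hGc := hpos (c * k u) (by positivity)
    calc u ^ 2 * G (c * k u) = (u ^ 2 * G (a * k u)) * (G (c * k u) / G (a * k u)) := by
          rw [mul_assoc, mul_div_cancel₀ _ hGa.ne']
      _ ≤ G (c * k u) / G (a * k u) := mul_le_of_le_one_left (by positivity) h2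
      _ < l := h1

variable {H : ℝ → ℝ} {C : ℝ}

lemma tendsto_sq_mul_comp_mul_inv
    (hH0 : H 0 = 0) (hHeven : ∀ t, H (-t) = H t)
    (hα : 0 < α) (hpos : ∀ x > 0, 0 < G x)
    (hHG : Tendsto (fun X => H (1 / X) / G X) atTop (nhds C))
    (hkt : Tendsto k atTop atTop)
    (hGk : ∀ c > 0, Tendsto (fun u => u ^ 2 * G (c * k u)) atTop (nhds (c ^ (-α)))) (t : ℝ) :
    Tendsto (fun u => u ^ 2 * H (t * (k u)⁻¹)) atTop (nhds (C * |t| ^ α)) := by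
  rcases eq_or_ne t 0 with rfl | ht
  · simp [hH0, hα.ne']
  have ht' : 0 < |t| := abs_pos.2 ht
  have habs : ∀ s, H |s| = H s := by
    intro s
    rcases abs_choice s with h | h <;> rw [h]
    exact hHeven s
  have h1 := (hHG.comp (hkt.const_mul_atTop (inv_pos.2 ht'))).mul (hGk |t|⁻¹ (inv_pos.2 ht'))
  rw [inv_rpow ht'.le, ← rpow_neg ht'.le, neg_neg] at h1
  refine h1.congr' ?_
  filter_upwards [hkt.eventually_gt_atTop 0] with u hku
  have hGp := hpos (|t|⁻¹ * k u) (by positivity)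
  simp only [Function.comp]
  rw [← habs (t * (k u)⁻¹), abs_mul, abs_of_pos (inv_pos.2 hku)]
  have : 1 / (|t|⁻¹ * k u) = |t| * (k u)⁻¹ := by field_simp
  rw [this, mul_left_comm, div_mul_cancel₀ _ hGp.ne']

lemma exists_forall_sq_mul_comp_mul_inv_le
    (hH0 : H 0 = 0) (hHeven : ∀ t, H (-t) = H t)
    (hG : Antitone G) (hpos : ∀ x > 0, 0 < G x) (hC : 0 ≤ C)
    (hHG : Tendsto (fun X => H (1 / X) / G X) atTop (nhds C))
    (hkt : Tendsto k atTop atTop)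
    (hGk : ∀ c > 0, Tendsto (fun u => u ^ 2 * G (c * k u)) atTop (nhds (c ^ (-α))))
    {K : ℝ} (hK : 0 < K) :
    ∃ D > 0, ∀ᶠ u in atTop, ∀ t, |t| ≤ K → u ^ 2 * H (t * (k u)⁻¹) ≤ D := by
  have habs : ∀ s, H |s| = H s := by
    intro s
    rcases abs_choice s with h | h <;> rw [h]
    exact hHeven s
  obtain ⟨X₀, hX₀⟩ := eventually_atTop.1 (hHG.eventually_lt_const (lt_add_one C))
  refine ⟨(C + 1) * ((K⁻¹) ^ (-α) + 1), by positivity, ?_⟩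
  filter_upwards [hkt.eventually_gt_atTop 0,
    (hkt.const_mul_atTop (inv_pos.2 hK)).eventually_ge_atTop X₀,
    (hGk K⁻¹ (inv_pos.2 hK)).eventually_lt_const (lt_add_one _)] with u hku hX hu t ht
  rcases eq_or_ne t 0 with rfl | ht0
  · simp only [zero_mul, hH0, mul_zero]; positivity
  have ht' : 0 < |t| := abs_pos.2 ht0
  have hle : K⁻¹ * k u ≤ |t|⁻¹ * k u :=
    mul_le_mul_of_nonneg_right (inv_anti₀ ht' ht) hku.le
  have h1 := hX₀ (|t|⁻¹ * k u) (hX.trans hle)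
  rw [div_lt_iff₀ (hpos _ (by positivity))] at h1
  have : 1 / (|t|⁻¹ * k u) = |t| * (k u)⁻¹ := by field_simp
  rw [this] at h1
  rw [← habs (t * (k u)⁻¹), abs_mul, abs_of_pos (inv_pos.2 hku)]
  calc u ^ 2 * H (|t| * (k u)⁻¹) ≤ u ^ 2 * ((C + 1) * G (K⁻¹ * k u)) := by
        refine mul_le_mul_of_nonneg_left (h1.le.trans ?_) (by positivity)
        exact mul_le_mul_of_nonneg_left (hG hle) (by positivity)
    _ = (C + 1) * (u ^ 2 * G (K⁻¹ * k u)) := by ring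
    _ ≤ _ := mul_le_mul_of_nonneg_left hu.le (by positivity)

lemma exists_forall_sq_mul_comp_inv_div_two_pow_le (hα : 0 < α)
    (hpos : ∀ x > 0, 0 < G x) (hC : 0 < C)
    (hrv : ∀ c > 0, Tendsto (fun x => G (c * x) / G x) atTop (nhds (c ^ (-α))))
    (hHG : Tendsto (fun X => H (1 / X) / G X) atTop (nhds C))
    (hkt : Tendsto k atTop atTop)
    (hbd : ∃ D > 0, ∀ᶠ u in atTop, ∀ t, |t| ≤ 1 → u ^ 2 * H (t * (k u)⁻¹) ≤ D) :
    ∃ θ > 0, θ < 1 ∧ ∃ D > 0, ∀ᶠ u in atTop, ∀ m : ℕ,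
      u ^ 2 * H (1 / 2 ^ m * (k u)⁻¹) ≤ D * θ ^ m := by
  have h2 : (2 : ℝ) ^ (-α) < 1 := rpow_lt_one_of_one_lt_of_neg (by norm_num) (by linarith)
  obtain ⟨θ, hθ1, hθ2⟩ := exists_between h2
  have hθ0 : 0 < θ := lt_trans (by positivity) hθ1
  have hratio : Tendsto (fun X => H (1 / (2 * X)) / H (1 / X)) atTop (nhds ((2 : ℝ) ^ (-α))) := by
    have h3 := (((hHG.comp (tendsto_id.const_mul_atTop (zero_lt_two' ℝ))).mul
      (hrv 2 two_pos)).div hHG hC.ne')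
    rw [mul_comm C, mul_div_cancel_right₀ _ hC.ne'] at h3
    refine h3.congr' ?_
    filter_upwards [eventually_gt_atTop 0] with X hX
    have g1 := hpos X hX
    have g2 := hpos (2 * X) (by positivity)
    simp only [Function.comp, id, Pi.div_apply]
    field_simp
  obtain ⟨X₀, hX₀⟩ := eventually_atTop.1 ((hratio.eventually_lt_const hθ1).and
    ((hHG.eventually_const_lt hC).and (eventually_gt_atTop 0)))
  have hstep : ∀ X ≥ X₀, H (1 / (2 * X)) ≤ θ * H (1 / X) := by
    intro X hX
    obtain ⟨h1, h2, h3⟩ := hX₀ X hX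
    have : 0 < H (1 / X) := by
      have := mul_pos h2 (hpos X h3)
      rwa [div_mul_cancel₀ _ (hpos X h3).ne'] at this
    rw [div_lt_iff₀ this] at h1
    exact h1.le
  obtain ⟨D, hD, hbd⟩ := hbd
  refine ⟨θ, hθ0, hθ2, D, hD, ?_⟩
  filter_upwards [hbd, hkt.eventually_gt_atTop 0, hkt.eventually_ge_atTop X₀]
    with u hu hku hX m
  have iter : ∀ m : ℕ, H (1 / 2 ^ m * (k u)⁻¹) ≤ θ ^ m * H ((k u)⁻¹) := by
    intro m
    induction m with
    | zero => simp
    | succ m ih =>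
      have hge : X₀ ≤ 2 ^ m * k u :=
        hX.trans (le_mul_of_one_le_left hku.le (one_le_pow₀ (by norm_num)))
      have := hstep _ hge
      have e1 : 1 / (2 * (2 ^ m * k u)) = 1 / 2 ^ (m + 1) * (k u)⁻¹ := by
        rw [pow_succ]; field_simp
      have e2 : 1 / (2 ^ m * k u) = 1 / 2 ^ m * (k u)⁻¹ := by field_simp
      rw [e1, e2] at this
      calc _ ≤ _ := this
        _ ≤ θ * (θ ^ m * H ((k u)⁻¹)) := mul_le_mul_of_nonneg_left ih hθ0.le
        _ = _ := by ring
  calc u ^ 2 * H (1 / 2 ^ m * (k u)⁻¹) ≤ u ^ 2 * (θ ^ m * H ((k u)⁻¹)) :=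
        mul_le_mul_of_nonneg_left (iter m) (by positivity)
    _ = θ ^ m * (u ^ 2 * H (1 * (k u)⁻¹)) := by rw [one_mul]; ring
    _ ≤ θ ^ m * D := mul_le_mul_of_nonneg_left (hu 1 (by simp)) (by positivity)
    _ = D * θ ^ m := mul_comm _ _

end Scaling

section SpectralMeasure

open Real Set

variable {μ : Measure ℝ} [IsFiniteMeasure μ] {R : ℝ → ℝ} {α : ℝ}

lemma integrable_cos_mul (t : ℝ) : Integrable (fun x => cos (t * x)) μ :=
  Integrable.of_bound (by fun_prop) 1 (Eventually.of_forall fun x => abs_cos_le_one _)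

lemma eq_integral_cos_of_fourier
    (hR : ∀ t : ℝ, (R t : ℂ) = ∫ x : ℝ, Complex.exp (Complex.I * t * x) ∂μ) (t : ℝ) :
    R t = ∫ x, cos (t * x) ∂μ := by
  have hinteg : Integrable (fun x : ℝ => Complex.exp (Complex.I * t * x)) μ := by
    refine Integrable.of_bound (by fun_prop) 1 (Eventually.of_forall fun x => ?_)
    have : Complex.I * t * x = ((t * x : ℝ) : ℂ) * Complex.I := by push_cast; ring
    rw [this, Complex.norm_exp_ofReal_mul_I]
  have h1 := congrArg Complex.re (hR t)
  rw [Complex.ofReal_re] at h1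
  have h2 := integral_re hinteg
  simp only [RCLike.re_to_complex] at h2
  rw [h1, ← h2]
  congr 1 with x
  have : Complex.I * t * x = ((t * x : ℝ) : ℂ) * Complex.I := by push_cast; ring
  rw [this, Complex.exp_ofReal_mul_I_re]

lemma sub_eq_integral_one_sub_cos (hR : ∀ t, R t = ∫ x, cos (t * x) ∂μ) (t : ℝ) :
    R 0 - R t = ∫ x, (1 - cos (t * x)) ∂μ := by
  rw [hR 0, hR t, ← integral_sub (integrable_cos_mul 0) (integrable_cos_mul t)]
  simp

lemma sub_nonneg_of_eq_integral_cos (hR : ∀ t, R t = ∫ x, cos (t * x) ∂μ) (t : ℝ) :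
    0 ≤ R 0 - R t := by
  rw [sub_eq_integral_one_sub_cos hR]
  exact integral_nonneg fun x => sub_nonneg.2 (cos_le_one _)

lemma even_of_eq_integral_cos {μ : Measure ℝ} (hR : ∀ t, R t = ∫ x, cos (t * x) ∂μ) (t : ℝ) :
    R (-t) = R t := by
  simp [hR]

lemma zero_pos_of_eq_integral_cos (hμ : μ univ ≠ 0) (hR : ∀ t, R t = ∫ x, cos (t * x) ∂μ) :
    0 < R 0 := by
  rw [hR]
  simpa [measureReal_def, ENNReal.toReal_pos_iff, pos_iff_ne_zero] using hμ

lemma sq_sub_le_mul_of_eq_integral_cos (hR : ∀ t, R t = ∫ x, cos (t * x) ∂μ) (a b : ℝ) :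
    (R a - R b) ^ 2 ≤ (R 0 - R (a + b)) * (R 0 - R (a - b)) := by
  have hq : ∀ l : ℝ, 0 ≤ (R 0 - R (a + b)) * (l * l) + 2 * (R b - R a) * l + (R 0 - R (a - b)) := by
    intro l
    have hi : ∀ t, Integrable (fun x => 1 - cos (t * x)) μ := fun t =>
      (integrable_const 1).sub (integrable_cos_mul t)
    have : (R 0 - R (a + b)) * (l * l) + 2 * (R b - R a) * l + (R 0 - R (a - b))
        = ∫ x, ((1 - cos ((a + b) * x)) * (l * l) + 2 * (cos (b * x) - cos (a * x)) * l
          + (1 - cos ((a - b) * x))) ∂μ := by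
      rw [integral_add _ (hi _), integral_add ((hi _).mul_const _) _, integral_mul_const,
        integral_mul_const, integral_const_mul,
        integral_sub (integrable_cos_mul b) (integrable_cos_mul a),
        sub_eq_integral_one_sub_cos hR, sub_eq_integral_one_sub_cos hR, hR a, hR b]
      · exact (((integrable_cos_mul b).sub (integrable_cos_mul a)).const_mul 2).mul_const l
      · exact ((hi _).mul_const _).add
          ((((integrable_cos_mul b).sub (integrable_cos_mul a)).const_mul 2).mul_const l)
    rw [this]
    refine integral_nonneg fun x => ?_
    have e1 : (a + b) * x = 2 * ((a + b) * x / 2) := by ring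
    have e2 : (a - b) * x = 2 * ((a - b) * x / 2) := by ring
    have e3 : b * x = (a + b) * x / 2 - (a - b) * x / 2 := by ring
    have e4 : a * x = (a + b) * x / 2 + (a - b) * x / 2 := by ring
    show 0 ≤ _
    rw [e3, e4, e1, e2, cos_two_mul, cos_two_mul]
    simp only [mul_div_cancel_left₀ _ (two_ne_zero' ℝ)]
    rw [cos_sub, cos_add, cos_sq', cos_sq']
    nlinarith [sq_nonneg (l * sin ((a + b) * x / 2) + sin ((a - b) * x / 2))]
  have := discrim_le_zero hq
  rw [discrim] at this
  nlinarith

lemma tendsto_measureReal_Ici_atTop : Tendsto (fun x => μ.real (Ici x)) atTop (nhds 0) := by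
  have h := tendsto_measure_iInter_atTop (μ := μ) (s := fun x : ℝ => Ici x)
    (fun x => measurableSet_Ici.nullMeasurableSet) (fun x y hxy => Ici_subset_Ici.2 hxy)
    ⟨0, measure_ne_top _ _⟩
  have h0 : ⋂ x : ℝ, Ici x = ∅ := by
    ext y; simp only [mem_iInter, mem_Ici, mem_empty_iff_false, iff_false, not_forall, not_le]
    exact exists_gt y
  rw [h0, measure_empty] at h
  exact (ENNReal.tendsto_toReal ENNReal.zero_ne_top).comp h

lemma integral_one_sub_cos_eq_two_mul (hsymm : μ.map (fun x => -x) = μ) (t : ℝ) :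
    ∫ x, (1 - cos (t * x)) ∂μ = 2 * ∫ x in Ioi 0, (1 - cos (t * x)) ∂μ := by
  have hi : Integrable (fun x => 1 - cos (t * x)) μ :=
    (integrable_const 1).sub (integrable_cos_mul t)
  have hneg : ∫ x in Iio 0, (1 - cos (t * x)) ∂μ = ∫ x in Ioi 0, (1 - cos (t * x)) ∂μ := by
    conv_lhs => rw [← hsymm]
    rw [setIntegral_map measurableSet_Iio (by fun_prop) (by fun_prop)]
    have : (fun x : ℝ => -x) ⁻¹' Iio 0 = Ioi 0 := by ext x; simp
    rw [this]; simp
  have hle : ∫ x in Iic 0, (1 - cos (t * x)) ∂μ = ∫ x in Iio 0, (1 - cos (t * x)) ∂μ := by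
    refine setIntegral_eq_of_subset_of_forall_sdiff_eq_zero measurableSet_Iic Iio_subset_Iic_self ?_
    intro x hx
    have : x = 0 := le_antisymm hx.1 (not_lt.1 hx.2)
    simp [this]
  rw [← integral_add_compl measurableSet_Ioi hi (s := Ioi 0), compl_Ioi, hle, hneg, two_mul]

lemma tendsto_sub_div_measureReal_Ici (h0 : 0 < α) (h2 : α < 2)
    (hsymm : μ.map (fun x => -x) = μ) (hpos : ∀ x > 0, 0 < μ.real (Ici x))
    (hrv : ∀ c > 0, Tendsto (fun x => μ.real (Ici (c * x)) / μ.real (Ici x)) atTop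
      (nhds (c ^ (-α))))
    (hR : ∀ t, R t = ∫ x, cos (t * x) ∂μ) :
    Tendsto (fun X => (R 0 - R (1 / X)) / μ.real (Ici X)) atTop
      (nhds (π / (Gamma α * sin (π * α / 2)))) := by
  have h := (tendsto_integral_one_sub_cos_div h0 h2 hpos hrv).const_mul 2
  rw [mul_div_cancel₀ _ (two_ne_zero' ℝ)] at h
  refine h.congr fun X => ?_
  rw [sub_eq_integral_one_sub_cos hR, integral_one_sub_cos_eq_two_mul hsymm, mul_div_assoc]
  simp_rw [one_div_mul_eq_div]

end SpectralMeasure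

section DyadicInterpolation

open Real Set

/-- The hat function of the dyadic grid of mesh `2⁻ʲ` centred at `i / 2ʲ`. -/
noncomputable def dyadicHat (j : ℕ) (i : ℤ) : C(ℝ, ℝ) where
  toFun t := max 0 (1 - |2 ^ j * t - i|)
  continuous_toFun := by fun_prop

/-- Piecewise linear function with prescribed values at the points `i / 2ʲ`, `|i| ≤ 4ʲ`. -/
noncomputable def dyadicSpline (j : ℕ) (v : {i : ℤ // i ∈ Finset.Icc (-4 ^ j) (4 ^ j)} → ℝ) :
    C(ℝ, ℝ) :=
  ∑ i, v i • dyadicHat j i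

/-- Piecewise linear interpolation of `f` at the points `i / 2ʲ`, `|i| ≤ 4ʲ`. -/
noncomputable def dyadicInterp (j : ℕ) (f : C(ℝ, ℝ)) : C(ℝ, ℝ) :=
  dyadicSpline j fun i => f ((i : ℤ) / 2 ^ j)

lemma continuous_dyadicSpline (j : ℕ) : Continuous (dyadicSpline j) := by
  unfold dyadicSpline; fun_prop

lemma dyadicInterp_apply {j : ℕ} {f : C(ℝ, ℝ)} {K : ℕ} (hK : K + 1 ≤ 2 ^ j) {t : ℝ}
    (ht : |t| ≤ K) :
    dyadicInterp j f t = (1 - Int.fract (2 ^ j * t)) * f (⌊2 ^ j * t⌋ / 2 ^ j)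
      + Int.fract (2 ^ j * t) * f ((⌊2 ^ j * t⌋ + 1) / 2 ^ j) := by
  have hsum : dyadicInterp j f t
      = ∑ i ∈ Finset.Icc (-4 ^ j : ℤ) (4 ^ j), f (i / 2 ^ j) * max 0 (1 - |2 ^ j * t - i|) := by
    rw [dyadicInterp, dyadicSpline, ContinuousMap.sum_apply]
    exact Finset.sum_coe_sort _ fun i : ℤ => f (i / 2 ^ j) * max 0 (1 - |2 ^ j * t - i|)
  rw [hsum]
  set y := 2 ^ j * t with hy
  have hK' : (K : ℝ) + 1 ≤ 2 ^ j := by exact_mod_cast hK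
  have h4 : (4 : ℝ) ^ j = 2 ^ j * 2 ^ j := by rw [← mul_pow]; norm_num
  have h2 : (1 : ℝ) ≤ 2 ^ j := one_le_pow₀ (by norm_num)
  have hyabs : |y| + 1 ≤ 4 ^ j := by
    rw [hy, abs_mul, abs_of_pos (by positivity), h4]
    nlinarith
  have hy1 := (abs_le.1 (le_sub_iff_add_le.2 hyabs)).1
  have hy2 := (abs_le.1 (le_sub_iff_add_le.2 hyabs)).2
  have hfl := Int.floor_le y
  have hlf := Int.lt_floor_add_one y
  have hm1 : ⌊y⌋ ∈ Finset.Icc (-4 ^ j : ℤ) (4 ^ j) := by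
    rw [Finset.mem_Icc]
    constructor
    · rw [Int.le_floor]; push_cast; linarith
    · have : (⌊y⌋ : ℝ) ≤ 4 ^ j := by linarith
      exact_mod_cast this
  have hm2 : ⌊y⌋ + 1 ∈ Finset.Icc (-4 ^ j : ℤ) (4 ^ j) := by
    rw [Finset.mem_Icc] at hm1 ⊢
    constructor
    · linarith [hm1.1]
    · have : (⌊y⌋ : ℝ) + 1 ≤ 4 ^ j := by linarith
      exact_mod_cast this
  rw [Finset.sum_eq_add_of_mem ⌊y⌋ (⌊y⌋ + 1) hm1 hm2 (by simp)]
  · have e1 : y - ⌊y⌋ = Int.fract y := rfl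
    have f0 := Int.fract_nonneg y
    have f1 := (Int.fract_lt_one y).le
    push_cast
    rw [← sub_sub, e1, abs_of_nonneg f0, abs_of_nonpos (by linarith), max_eq_right (by linarith),
      max_eq_right (by linarith)]
    ring
  · intro i _ hi
    rw [max_eq_left, mul_zero]
    rw [sub_nonpos]
    rcases lt_or_gt_of_ne hi.1 with h | h
    · have : (i : ℝ) + 1 ≤ ⌊y⌋ := by exact_mod_cast h
      rw [le_abs]; left; linarith
    · have h' : ⌊y⌋ + 2 ≤ i := by
        have := hi.2; omega
      have : (⌊y⌋ : ℝ) + 2 ≤ i := by exact_mod_cast h'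
      rw [le_abs]; right; linarith

lemma abs_dyadicInterp_sub_le {j : ℕ} {f : C(ℝ, ℝ)} {K : ℕ} (hK : K + 1 ≤ 2 ^ j) {t x ε : ℝ}
    (ht : |t| ≤ K) (h1 : |f (⌊2 ^ j * t⌋ / 2 ^ j) - x| ≤ ε)
    (h2 : |f ((⌊2 ^ j * t⌋ + 1) / 2 ^ j) - x| ≤ ε) : |dyadicInterp j f t - x| ≤ ε := by
  rw [dyadicInterp_apply hK ht]
  have f0 := Int.fract_nonneg (2 ^ j * t)
  have f1 := (Int.fract_lt_one (2 ^ j * t)).le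
  set s := Int.fract (2 ^ j * t)
  rw [abs_le] at *
  constructor <;> nlinarith

lemma abs_floor_two_pow_div_sub_le (j : ℕ) (t : ℝ) : |⌊2 ^ j * t⌋ / 2 ^ j - t| ≤ (1 / 2) ^ j := by
  have h2 : (0 : ℝ) < 2 ^ j := by positivity
  have : (⌊2 ^ j * t⌋ : ℝ) / 2 ^ j - t = -(Int.fract (2 ^ j * t)) * (1 / 2) ^ j := by
    rw [← Int.self_sub_floor, one_div, inv_pow]; field_simp; ring
  rw [this, abs_mul, abs_neg, abs_of_nonneg (Int.fract_nonneg _), abs_of_pos (by positivity)]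
  exact mul_le_of_le_one_left (by positivity) (Int.fract_lt_one _).le

lemma abs_floor_add_one_div_sub_le (j : ℕ) (t : ℝ) :
    |(⌊2 ^ j * t⌋ + 1) / 2 ^ j - t| ≤ (1 / 2) ^ j := by
  have h2 : (0 : ℝ) < 2 ^ j := by positivity
  have : (⌊2 ^ j * t⌋ + 1 : ℝ) / 2 ^ j - t = (1 - Int.fract (2 ^ j * t)) * (1 / 2) ^ j := by
    rw [← Int.self_sub_floor, one_div, inv_pow]; field_simp; ring
  rw [this, abs_mul, abs_of_nonneg (by linarith [Int.fract_lt_one (2 ^ j * t)]),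
    abs_of_pos (by positivity)]
  exact mul_le_of_le_one_left (by positivity) (by linarith [Int.fract_nonneg (2 ^ j * t)])

lemma tendsto_dyadicInterp (f : C(ℝ, ℝ)) :
    Tendsto (fun j => dyadicInterp j f) atTop (nhds f) := by
  rw [ContinuousMap.tendsto_iff_forall_isCompact_tendstoUniformlyOn]
  intro S hS
  obtain ⟨K₀, hK₀⟩ := hS.isBounded.exists_norm_le
  obtain ⟨K, hK⟩ := exists_nat_ge K₀
  rw [Metric.tendstoUniformlyOn_iff]
  intro ε hε
  have huc := (isCompact_Icc (a := -(K : ℝ) - 1) (b := K + 1)).uniformContinuousOn_of_continuous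
    f.continuous.continuousOn
  rw [Metric.uniformContinuousOn_iff] at huc
  obtain ⟨d, hd, hfd⟩ := huc (ε / 2) (half_pos hε)
  have h0 : Tendsto (fun j : ℕ => (1 / 2 : ℝ) ^ j) atTop (nhds 0) :=
    tendsto_pow_atTop_nhds_zero_of_lt_one (by norm_num) (by norm_num)
  filter_upwards [h0.eventually_lt_const hd, eventually_ge_atTop (K + 1)] with j hj hjK t ht
  have hjK' : K + 1 ≤ 2 ^ j := hjK.trans j.lt_two_pow_self.le
  have htK : |t| ≤ K := (hK₀ t ht).trans hK
  have hle : (1 / 2 : ℝ) ^ j ≤ 1 := pow_le_one₀ (by norm_num) (by norm_num)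
  have key : ∀ s, |s - t| ≤ (1 / 2) ^ j → |f s - f t| ≤ ε / 2 := by
    intro s hs
    have h1 := abs_le.1 (hs.trans hle)
    have h2 := abs_le.1 htK
    refine (hfd s ⟨by linarith, by linarith⟩ t ⟨by linarith, by linarith⟩ ?_).le
    rw [Real.dist_eq]; exact hs.trans_lt hj
  rw [dist_comm, Real.dist_eq]
  refine (abs_dyadicInterp_sub_le hjK' htK (key _ (abs_floor_two_pow_div_sub_le j t))
    (key _ (abs_floor_add_one_div_sub_le j t))).trans_lt (half_lt_self hε)

/-- Dyadic chaining: control of the dyadic increments beyond level `j` controls the interpolation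
error at level `j`. -/
lemma abs_dyadicInterp_sub_le_of_increments {j : ℕ} {f : C(ℝ, ℝ)} {K : ℕ} (hK : K + 1 ≤ 2 ^ j)
    {b : ℝ} (hb0 : 0 < b) (hb1 : b < 1)
    (hinc : ∀ m ≥ j, ∀ k : ℤ, |k| ≤ K * 2 ^ m → |f ((k + 1) / 2 ^ m) - f (k / 2 ^ m)| ≤ b ^ m)
    {t : ℝ} (ht : |t| ≤ K) : |dyadicInterp j f t - f t| ≤ 2 / (1 - b) * b ^ j := by
  have hfloor : ∀ m : ℕ, |⌊2 ^ m * t⌋| ≤ (K : ℤ) * 2 ^ m := by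
    intro m
    have h2 : (0 : ℝ) < 2 ^ m := by positivity
    have h1 := abs_le.1 ht
    rw [abs_le]
    constructor
    · rw [Int.le_floor]; push_cast; nlinarith
    · have : (⌊2 ^ m * t⌋ : ℝ) ≤ K * 2 ^ m := (Int.floor_le _).trans (by nlinarith)
      exact_mod_cast this
  have hstep : ∀ m ≥ j, |f (⌊2 ^ m * t⌋ / 2 ^ m) - f (⌊2 ^ (m + 1) * t⌋ / 2 ^ (m + 1))|
      ≤ b ^ (m + 1) := by
    intro m hm
    set y := 2 ^ m * t
    have hy : 2 ^ (m + 1) * t = 2 * y := by simp only [y]; ring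
    have h2 : (0 : ℝ) < 2 ^ m := by positivity
    have e1 : (⌊y⌋ : ℝ) / 2 ^ m = ((2 * ⌊y⌋ : ℤ) : ℝ) / 2 ^ (m + 1) := by
      push_cast; rw [pow_succ]; field_simp
    have hbd : |2 * ⌊y⌋| ≤ (K : ℤ) * 2 ^ (m + 1) := by
      have := hfloor m
      rw [abs_mul, pow_succ]
      have h3 : |(2 : ℤ)| = 2 := rfl
      rw [h3]; nlinarith
    rw [hy, e1]
    have hcase : ⌊2 * y⌋ = 2 * ⌊y⌋ ∨ ⌊2 * y⌋ = 2 * ⌊y⌋ + 1 := by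
      have g1 : 2 * ⌊y⌋ ≤ ⌊2 * y⌋ := by
        rw [Int.le_floor]; push_cast; linarith [Int.floor_le y]
      have g2 : ⌊2 * y⌋ < 2 * ⌊y⌋ + 2 := by
        rw [Int.floor_lt]; push_cast; linarith [Int.lt_floor_add_one y]
      omega
    rcases hcase with h | h <;> rw [h]
    · simp; positivity
    · rw [abs_sub_comm]
      have := hinc (m + 1) (by omega) _ hbd
      push_cast at this ⊢
      exact this
  have hlim : Tendsto (fun n => f (⌊2 ^ (j + n) * t⌋ / 2 ^ (j + n))) atTop (nhds (f t)) := by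
    refine (f.continuous.tendsto t).comp ?_
    rw [tendsto_iff_dist_tendsto_zero]
    refine squeeze_zero (fun _ => dist_nonneg) (fun n => abs_floor_two_pow_div_sub_le (j + n) t) ?_
    have := (tendsto_pow_atTop_nhds_zero_of_lt_one (r := (1 / 2 : ℝ)) (by norm_num)
      (by norm_num)).comp (tendsto_add_atTop_nat j)
    refine this.congr fun n => ?_
    simp [Function.comp, add_comm]
  have hgeo := dist_le_of_le_geometric_of_tendsto₀ (r := b) (C := b ^ j) hb1 (fun n => ?_) hlim
  · rw [Real.dist_eq, add_zero] at hgeo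
    have hd1 : 0 < 1 - b := by linarith
    have h1 := hinc j le_rfl _ (hfloor j)
    have hbj : 0 < b ^ j := by positivity
    have h3 : |dyadicInterp j f t - f (⌊2 ^ j * t⌋ / 2 ^ j)| ≤ b ^ j :=
      abs_dyadicInterp_sub_le hK ht (by simpa using hbj.le) h1
    have h4 : b ^ j ≤ b ^ j / (1 - b) := le_div_self hbj.le hd1 (by linarith)
    calc _ ≤ _ := abs_sub_le _ (f (⌊2 ^ j * t⌋ / 2 ^ j)) _
      _ ≤ b ^ j / (1 - b) + b ^ j / (1 - b) := add_le_add (h3.trans h4) hgeo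
      _ = _ := by ring
  · rw [Real.dist_eq]
    have := hstep (j + n) (by omega)
    calc _ ≤ b ^ (j + n + 1) := this
      _ ≤ b ^ (j + n) := pow_le_pow_of_le_one hb0.le hb1.le (by omega)
      _ = _ := pow_add _ _ _

end DyadicInterpolation

section WeakConvergence

open Real Set

lemma tendsto_integral_comp_of_tendsto_charFun {ι : Type} [Fintype ι] {Ω Ω' : Type*}
    [MeasurableSpace Ω] [MeasurableSpace Ω'] {P : ℕ → Measure Ω} [∀ n, IsProbabilityMeasure (P n)]
    {Q : Measure Ω'} [IsProbabilityMeasure Q] {Z : ℕ → ι → Ω → ℝ} {W : ι → Ω' → ℝ}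
    (hZ : ∀ n i, Measurable (Z n i)) (hW : ∀ i, Measurable (W i))
    (h : ∀ c : ι → ℝ, Tendsto
      (fun n => ∫ ω, Complex.exp ((∑ i, c i * Z n i ω : ℝ) * Complex.I) ∂P n) atTop
      (nhds (∫ ω, Complex.exp ((∑ i, c i * W i ω : ℝ) * Complex.I) ∂Q)))
    {g : (ι → ℝ) → ℝ} (hg : Continuous g) {M : ℝ} (hM : ∀ v, |g v| ≤ M) :
    Tendsto (fun n => ∫ ω, g (fun i => Z n i ω) ∂P n) atTop
      (nhds (∫ ω, g (fun i => W i ω) ∂Q)) := by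
  have mZ : ∀ n, Measurable fun ω => WithLp.toLp 2 (fun i => Z n i ω) := fun n =>
    (WithLp.measurable_toLp 2 _).comp (measurable_pi_lambda _ (hZ n))
  have mW : Measurable fun ω => WithLp.toLp 2 (fun i => W i ω) :=
    (WithLp.measurable_toLp 2 _).comp (measurable_pi_lambda _ hW)
  let μs : ℕ → ProbabilityMeasure (EuclideanSpace ℝ ι) := fun n =>
    ⟨(P n).map _, Measure.isProbabilityMeasure_map (mZ n).aemeasurable⟩
  let ν : ProbabilityMeasure (EuclideanSpace ℝ ι) :=
    ⟨Q.map _, Measure.isProbabilityMeasure_map mW.aemeasurable⟩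
  have key : Tendsto μs atTop (nhds ν) := by
    refine ProbabilityMeasure.tendsto_of_tendsto_charFun fun c => ?_
    simp only [μs, ν, ProbabilityMeasure.coe_mk, charFun_apply]
    rw [integral_map mW.aemeasurable (by fun_prop)]
    simp_rw [integral_map (mZ _).aemeasurable
      (f := fun x => Complex.exp ((inner ℝ x c : ℝ) * Complex.I)) (by fun_prop)]
    have := h c
    simpa [PiLp.inner_apply] using this
  let g' : BoundedContinuousFunction (EuclideanSpace ℝ ι) ℝ :=
    BoundedContinuousFunction.ofNormedAddCommGroup (fun v => g (WithLp.ofLp v))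
      (hg.comp (PiLp.continuous_ofLp 2 _)) M fun v => hM _
  have hb := ProbabilityMeasure.tendsto_iff_forall_integral_tendsto.1 key g'
  simp only [μs, ν, ProbabilityMeasure.coe_mk] at hb
  rw [integral_map mW.aemeasurable g'.continuous.aestronglyMeasurable] at hb
  refine hb.congr fun n => ?_
  rw [integral_map (mZ n).aemeasurable g'.continuous.aestronglyMeasurable]
  rfl

lemma measurable_borel_of_forall_apply {Ω : Type*} [MeasurableSpace Ω] {Z : Ω → C(ℝ, ℝ)}
    (hZ : ∀ t, Measurable fun ω => Z ω t) : Measurable[_, borel C(ℝ, ℝ)] Z := by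
  let : MeasurableSpace C(ℝ, ℝ) := borel _
  have : BorelSpace C(ℝ, ℝ) := ⟨rfl⟩
  refine measurable_of_tendsto_metrizable (f := fun j ω => dyadicInterp j (Z ω)) (fun j => ?_)
    (tendsto_pi_nhds.2 fun ω => tendsto_dyadicInterp (Z ω))
  exact (continuous_dyadicSpline j).measurable.comp (measurable_pi_lambda _ fun i => hZ _)

/-- Weak convergence in `C(ℝ)` follows from convergence of the integrals of bounded uniformly
continuous functionals. -/
lemma tendsto_integral_of_forall_uniformContinuous {Ω Ω' : Type*}
    [MeasurableSpace Ω] [MeasurableSpace Ω'] {P : ℕ → Measure Ω} [∀ n, IsProbabilityMeasure (P n)]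
    {Q : Measure Ω'} [IsProbabilityMeasure Q] {Z : ℕ → Ω → C(ℝ, ℝ)} {W : Ω' → C(ℝ, ℝ)}
    (hZ : ∀ n t, Measurable fun ω => Z n ω t) (hW : ∀ t, Measurable fun ω => W ω t)
    (h : ∀ F : C(ℝ, ℝ) → ℝ, UniformContinuous F → (∃ M, ∀ f, |F f| ≤ M) →
      Tendsto (fun n => ∫ ω, F (Z n ω) ∂P n) atTop (nhds (∫ ω, F (W ω) ∂Q)))
    (F : BoundedContinuousFunction C(ℝ, ℝ) ℝ) :
    Tendsto (fun n => ∫ ω, F (Z n ω) ∂P n) atTop (nhds (∫ ω, F (W ω) ∂Q)) := by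
  let : MeasurableSpace C(ℝ, ℝ) := borel _
  have : BorelSpace C(ℝ, ℝ) := ⟨rfl⟩
  let : PseudoMetricSpace C(ℝ, ℝ) := UniformSpace.pseudoMetricSpace _
  have mZ n : Measurable (Z n) := measurable_borel_of_forall_apply (hZ n)
  have mW : Measurable W := measurable_borel_of_forall_apply hW
  let μs : ℕ → ProbabilityMeasure C(ℝ, ℝ) := fun n =>
    ⟨(P n).map (Z n), Measure.isProbabilityMeasure_map (mZ n).aemeasurable⟩
  let ν : ProbabilityMeasure C(ℝ, ℝ) :=
    ⟨Q.map W, Measure.isProbabilityMeasure_map mW.aemeasurable⟩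
  have key : Tendsto μs atTop (nhds ν) := by
    rw [tendsto_iff_forall_lipschitz_integral_tendsto]
    rintro f ⟨M, hM⟩ ⟨L, hL⟩
    simp only [μs, ν, ProbabilityMeasure.coe_mk]
    rw [integral_map mW.aemeasurable hL.continuous.aestronglyMeasurable]
    simp_rw [integral_map (mZ _).aemeasurable hL.continuous.aestronglyMeasurable]
    refine h f hL.uniformContinuous ⟨M + |f 0|, fun g => ?_⟩
    have := hM g 0
    rw [Real.dist_eq] at this
    linarith [abs_sub_abs_le_abs_sub (f g) (f 0)]
  have hb := ProbabilityMeasure.tendsto_iff_forall_integral_tendsto.1 key F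
  simp only [μs, ν, ProbabilityMeasure.coe_mk] at hb
  rw [integral_map mW.aemeasurable F.continuous.aestronglyMeasurable] at hb
  refine hb.congr fun n => ?_
  rw [integral_map (mZ n).aemeasurable F.continuous.aestronglyMeasurable]

lemma measureReal_iUnion_increments_le {Ω : Type*} [MeasurableSpace Ω] {P : Measure Ω}
    [IsProbabilityMeasure P] {Z : Ω → C(ℝ, ℝ)} {K : ℕ} {b C r : ℝ} (hC : 0 ≤ C)
    (hr0 : 0 ≤ r) (hr : r < 1 / 2)
    (h : ∀ (m : ℕ) (k : ℤ), |k| ≤ K * 2 ^ m →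
      P.real {ω | b ^ m < |Z ω ((k + 1) / 2 ^ m) - Z ω (k / 2 ^ m)|} ≤ C * r ^ m) (j : ℕ) :
    P.real {ω | ∃ m ≥ j, ∃ k : ℤ, |k| ≤ K * 2 ^ m ∧
      b ^ m < |Z ω ((k + 1) / 2 ^ m) - Z ω (k / 2 ^ m)|}
        ≤ (2 * K + 1) * C / (1 - 2 * r) * (2 * r) ^ j := by
  let A : ℕ → ℤ → Set Ω := fun m k =>
    {ω | b ^ m < |Z ω ((k + 1) / 2 ^ m) - Z ω (k / 2 ^ m)|}
  have hr1 : 2 * r < 1 := by linarith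
  have hlevel : ∀ m, P.real (⋃ k ∈ Finset.Icc (-(K * 2 ^ m) : ℤ) (K * 2 ^ m), A m k)
      ≤ (2 * K + 1) * C * (2 * r) ^ m := by
    intro m
    refine (measureReal_biUnion_finset_le _ _).trans ?_
    refine (Finset.sum_le_card_nsmul _ _ (C * r ^ m) fun k hk => h m k ?_).trans ?_
    · rw [Finset.mem_Icc] at hk; exact abs_le.2 hk
    · rw [nsmul_eq_mul, Int.card_Icc]
      have : (((K * 2 ^ m + 1 - -(K * 2 ^ m) : ℤ).toNat : ℕ) : ℝ) = 2 * K * 2 ^ m + 1 := by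
        have h1 : ((K * 2 ^ m + 1 - -(K * 2 ^ m) : ℤ)).toNat = 2 * K * 2 ^ m + 1 := by
          have : (K * 2 ^ m + 1 - -(K * 2 ^ m) : ℤ) = ((2 * K * 2 ^ m + 1 : ℕ) : ℤ) := by
            push_cast; ring
          rw [this, Int.toNat_natCast]
        rw [h1]; push_cast; ring
      rw [this, mul_pow]
      have h2 : (1 : ℝ) ≤ 2 ^ m := one_le_pow₀ (by norm_num)
      have h3 : 0 ≤ C * r ^ m := by positivity
      nlinarith
  have hsub : {ω | ∃ m ≥ j, ∃ k : ℤ, |k| ≤ K * 2 ^ m ∧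
      b ^ m < |Z ω ((k + 1) / 2 ^ m) - Z ω (k / 2 ^ m)|}
      ⊆ ⋃ n : ℕ, ⋃ k ∈ Finset.Icc (-(K * 2 ^ (j + n)) : ℤ) (K * 2 ^ (j + n)), A (j + n) k := by
    rintro ω ⟨m, hm, k, hk, hω⟩
    obtain ⟨n, rfl⟩ := Nat.exists_eq_add_of_le hm
    simp only [mem_iUnion]
    exact ⟨n, k, Finset.mem_Icc.2 (abs_le.1 hk), hω⟩
  have hs : HasSum (fun n => (2 * K + 1) * C * (2 * r) ^ (j + n))
      ((2 * K + 1) * C / (1 - 2 * r) * (2 * r) ^ j) := by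
    have := (hasSum_geometric_of_lt_one (by positivity) hr1).mul_left
      ((2 * K + 1) * C * (2 * r) ^ j)
    convert! this using 1
    · ext n; rw [pow_add]; ring
    · field_simp
  refine ENNReal.toReal_le_of_le_ofReal ?_ ?_
  · have : 0 < 1 - 2 * r := by linarith
    positivity
  · refine (measure_mono hsub).trans ((measure_iUnion_le _).trans ?_)
    rw [← hs.tsum_eq, ENNReal.ofReal_tsum_of_nonneg (fun n => by positivity) hs.summable]
    refine ENNReal.tsum_le_tsum fun n => ?_
    rw [← ENNReal.ofReal_toReal (measure_ne_top P _)]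
    exact ENNReal.ofReal_le_ofReal (hlevel _)

/-- A criterion for weak convergence in `C(ℝ)`: convergence of the finite-dimensional characteristic
functions and uniform geometric control of the dyadic increments. -/
theorem tendsto_integral_of_tendsto_charFun_of_increments {Ω Ω' : Type*}
    [MeasurableSpace Ω] [MeasurableSpace Ω'] {P : ℕ → Measure Ω} [∀ n, IsProbabilityMeasure (P n)]
    {Q : Measure Ω'} [IsProbabilityMeasure Q] {Z : ℕ → Ω → C(ℝ, ℝ)} {W : Ω' → C(ℝ, ℝ)}
    (hZ : ∀ n t, Measurable fun ω => Z n ω t) (hW : ∀ t, Measurable fun ω => W ω t)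
    (hfdd : ∀ (ι : Type) [Fintype ι] (t c : ι → ℝ), Tendsto
      (fun n => ∫ ω, Complex.exp ((∑ i, c i * Z n ω (t i) : ℝ) * Complex.I) ∂P n) atTop
      (nhds (∫ ω, Complex.exp ((∑ i, c i * W ω (t i) : ℝ) * Complex.I) ∂Q)))
    (hinc : ∀ K : ℕ, ∃ b > 0, b < 1 ∧ ∃ r ≥ 0, r < 1 / 2 ∧ ∃ C ≥ 0, ∀ᶠ n in atTop,
      ∀ (m : ℕ) (k : ℤ), |k| ≤ K * 2 ^ m →
        (P n).real {ω | b ^ m < |Z n ω ((k + 1) / 2 ^ m) - Z n ω (k / 2 ^ m)|} ≤ C * r ^ m)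
    (F : BoundedContinuousFunction C(ℝ, ℝ) ℝ) :
    Tendsto (fun n => ∫ ω, F (Z n ω) ∂P n) atTop (nhds (∫ ω, F (W ω) ∂Q)) := by
  refine tendsto_integral_of_forall_uniformContinuous hZ hW ?_ F
  clear F
  rintro F hFu ⟨M, hM⟩
  have hM0 : 0 ≤ M := (abs_nonneg _).trans (hM 0)
  let : MeasurableSpace C(ℝ, ℝ) := borel _
  have : BorelSpace C(ℝ, ℝ) := ⟨rfl⟩
  have mZ n : Measurable (Z n) := measurable_borel_of_forall_apply (hZ n)
  have mW : Measurable W := measurable_borel_of_forall_apply hW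
  have mF : Measurable F := hFu.continuous.measurable
  have mI j : Measurable (dyadicInterp j) :=
    ((continuous_dyadicSpline j).comp
      (continuous_pi fun _ => continuous_eval_const _)).measurable
  have hspline : ∀ j, Tendsto (fun n => ∫ ω, F (dyadicInterp j (Z n ω)) ∂P n) atTop
      (nhds (∫ ω, F (dyadicInterp j (W ω)) ∂Q)) := fun j =>
    tendsto_integral_comp_of_tendsto_charFun
      (Z := fun n (i : {i : ℤ // i ∈ Finset.Icc (-4 ^ j : ℤ) (4 ^ j)}) ω => Z n ω ((i : ℤ) / 2 ^ j))
      (W := fun i ω => W ω ((i : ℤ) / 2 ^ j)) (fun n i => hZ n _) (fun i => hW _)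
      (fun c => hfdd _ _ c) (hFu.continuous.comp (continuous_dyadicSpline j)) (fun v => hM _)
  have hlimW : Tendsto (fun j => ∫ ω, F (dyadicInterp j (W ω)) ∂Q) atTop
      (nhds (∫ ω, F (W ω) ∂Q)) := by
    refine tendsto_integral_of_dominated_convergence (fun _ => M)
      (fun j => (mF.comp ((mI j).comp mW)).aestronglyMeasurable) (integrable_const _)
      (fun j => Eventually.of_forall fun ω => by simpa using hM _)
      (Eventually.of_forall fun ω =>
        (hFu.continuous.tendsto _).comp (tendsto_dyadicInterp (W ω)))
  rw [Metric.tendsto_atTop]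
  intro ε hε
  have hU : {fg : C(ℝ, ℝ) × C(ℝ, ℝ) | dist (F fg.1) (F fg.2) < ε / 4} ∈ uniformity C(ℝ, ℝ) :=
    hFu (Metric.dist_mem_uniformity (by positivity))
  rw [ContinuousMap.mem_compactConvergence_entourage_iff] at hU
  obtain ⟨S, V, hS, hV, hSV⟩ := hU
  obtain ⟨η, hη, hηV⟩ := Metric.mem_uniformity_dist.1 hV
  obtain ⟨K₀, hK₀⟩ := hS.isBounded.exists_norm_le
  obtain ⟨K, hK⟩ := exists_nat_ge K₀
  obtain ⟨b, hb0, hb1, r, hr0, hr, C, hC, hev⟩ := hinc K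
  have h1b : 0 < 1 - b := by linarith
  have h1r : 0 < 1 - 2 * r := by linarith
  have ht1 : Tendsto (fun j : ℕ => 2 / (1 - b) * b ^ j) atTop (nhds 0) := by
    simpa using (tendsto_pow_atTop_nhds_zero_of_lt_one hb0.le hb1).const_mul (2 / (1 - b))
  have ht2 : Tendsto (fun j : ℕ => 2 * M * ((2 * K + 1) * C / (1 - 2 * r) * (2 * r) ^ j)) atTop
      (nhds 0) := by
    simpa using ((tendsto_pow_atTop_nhds_zero_of_lt_one (r := 2 * r) (by positivity)
      (by linarith)).const_mul ((2 * K + 1) * C / (1 - 2 * r))).const_mul (2 * M)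
  obtain ⟨j, hj1, hj2, hj3, hj4⟩ := ((ht1.eventually_lt_const hη).and
    ((ht2.eventually_lt_const (show 0 < ε / 4 by positivity)).and
    ((eventually_ge_atTop (K + 1)).and
    (hlimW.eventually (Metric.ball_mem_nhds _ (show 0 < ε / 4 by positivity)))))).exists
  have hjK : K + 1 ≤ 2 ^ j := hj3.trans j.lt_two_pow_self.le
  have hj4' : |∫ ω, F (dyadicInterp j (W ω)) ∂Q - ∫ ω, F (W ω) ∂Q| < ε / 4 := hj4
  rw [← eventually_atTop]
  filter_upwards [hev, (hspline j).eventually (Metric.ball_mem_nhds _ (show 0 < ε / 4 by positivity))]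
    with n hn hn2
  have hn2' : |∫ ω, F (dyadicInterp j (Z n ω)) ∂P n - ∫ ω, F (dyadicInterp j (W ω)) ∂Q| < ε / 4 :=
    hn2
  have hbad := measureReal_iUnion_increments_le hC hr0 hr hn j
  set A := {ω | ∃ m ≥ j, ∃ k : ℤ, |k| ≤ K * 2 ^ m ∧
      b ^ m < |Z n ω ((k + 1) / 2 ^ m) - Z n ω (k / 2 ^ m)|} with hA
  have hAm : MeasurableSet A := by
    simp only [hA, ofPred_exists, ofPred_and]
    exact MeasurableSet.iUnion fun m => (MeasurableSet.const _).inter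
      (MeasurableSet.iUnion fun k => (MeasurableSet.const _).inter
        (measurableSet_lt measurable_const ((hZ n _).sub (hZ n _)).norm))
  have hpt : ∀ ω, |F (Z n ω) - F (dyadicInterp j (Z n ω))|
      ≤ ε / 4 + A.indicator (fun _ => 2 * M) ω := by
    intro ω
    by_cases hω : ω ∈ A
    · rw [indicator_of_mem hω]
      calc _ ≤ |F (Z n ω)| + |F (dyadicInterp j (Z n ω))| := abs_sub _ _
        _ ≤ M + M := add_le_add (hM _) (hM _)
        _ ≤ _ := by linarith
    · rw [indicator_of_notMem hω, add_zero]
      have hgood : ∀ m ≥ j, ∀ k : ℤ, |k| ≤ K * 2 ^ m →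
          |Z n ω ((k + 1) / 2 ^ m) - Z n ω (k / 2 ^ m)| ≤ b ^ m := by
        intro m hm k hk
        by_contra! hlt
        exact hω ⟨m, hm, k, hk, hlt⟩
      refine (hSV (a := (Z n ω, dyadicInterp j (Z n ω))) fun x hx => hηV ?_).le
      rw [dist_comm, Real.dist_eq]
      exact (abs_dyadicInterp_sub_le_of_increments hjK hb0 hb1 hgood
        ((hK₀ x hx).trans hK)).trans_lt hj1
  have i1 : Integrable (fun ω => F (Z n ω)) (P n) :=
    Integrable.of_bound (mF.comp (mZ n)).aestronglyMeasurable M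
      (Eventually.of_forall fun ω => by simpa using hM _)
  have i2 : Integrable (fun ω => F (dyadicInterp j (Z n ω))) (P n) :=
    Integrable.of_bound (mF.comp ((mI j).comp (mZ n))).aestronglyMeasurable M
      (Eventually.of_forall fun ω => by simpa using hM _)
  have h3 : |∫ ω, F (Z n ω) ∂P n - ∫ ω, F (dyadicInterp j (Z n ω)) ∂P n| < ε / 2 := by
    rw [← integral_sub i1 i2]
    calc _ ≤ ∫ ω, |F (Z n ω) - F (dyadicInterp j (Z n ω))| ∂P n := abs_integral_le_integral_abs
      _ ≤ ∫ ω, (ε / 4 + A.indicator (fun _ => 2 * M) ω) ∂P n :=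
        integral_mono (i1.sub i2).abs
          ((integrable_const _).add ((integrable_const _).indicator hAm)) hpt
      _ = ε / 4 + 2 * M * (P n).real A := by
        rw [integral_add (integrable_const _) ((integrable_const _).indicator hAm),
          integral_indicator_const _ hAm]
        simp [mul_comm]
      _ ≤ ε / 4 + 2 * M * ((2 * K + 1) * C / (1 - 2 * r) * (2 * r) ^ j) := by gcongr
      _ < ε / 2 := by linarith
  rw [Real.dist_eq]
  rw [abs_lt] at *
  constructor <;> linarith

end WeakConvergence

namespace IsZeroMeanGaussianProcess

open Real Set

/-- The residual of a linear combination of values of a stationary Gaussian process after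
regressing on the value at `0`. -/
lemma residual_eq {Ω ι : Type*} [Fintype ι] (X : ℝ → Ω → ℝ) (R : ℝ → ℝ) (t c : ι → ℝ) (ω : Ω) :
    (∑ i, c i * (X (t i) ω - R (t i) / R 0 * X 0 ω))
      = ∑ o : Option ι, (o.elim (-∑ i, c i * (R (t i) / R 0)) c) * X (o.elim 0 t) ω := by
  rw [Fintype.sum_option]
  simp only [Option.elim]
  simp_rw [mul_sub, Finset.sum_sub_distrib, ← mul_assoc, ← Finset.sum_mul]
  ring

variable {Ω : Type*} [MeasurableSpace Ω] {P : Measure Ω} {X : ℝ → Ω → ℝ}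
  {ι : Type} [Fintype ι]

lemma measurable_sum (hX : IsZeroMeanGaussianProcess P X) (t c : ι → ℝ) :
    Measurable fun ω => ∑ i, c i * X (t i) ω :=
  Finset.measurable_fun_sum _ fun i _ => (hX.1 (t i)).const_mul (c i)

lemma exists_map_sum_eq (hX : IsZeroMeanGaussianProcess P X) (t c : ι → ℝ) :
    ∃ v : NNReal, P.map (fun ω => ∑ i, c i * X (t i) ω) = gaussianReal 0 v := by
  let e := Fintype.equivFin ι
  obtain ⟨v, hv⟩ := hX.2 (Fintype.card ι) (t ∘ e.symm) (c ∘ e.symm)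
  refine ⟨v, ?_⟩
  rw [← hv]
  congr 1 with ω
  exact (Equiv.sum_comp e.symm fun i => c i * X (t i) ω).symm

lemma exists_map_eq (hX : IsZeroMeanGaussianProcess P X) (t : ℝ) :
    ∃ v : NNReal, P.map (X t) = gaussianReal 0 v := by
  simpa using hX.exists_map_sum_eq (ι := Unit) (fun _ => t) (fun _ => 1)

lemma memLp (hX : IsZeroMeanGaussianProcess P X) (t : ℝ) (p : NNReal) : MemLp (X t) p P := by
  obtain ⟨v, hv⟩ := hX.exists_map_eq t
  have := memLp_id_gaussianReal (μ := 0) (v := v) p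
  rw [← hv, memLp_map_measure_iff aestronglyMeasurable_id (hX.1 t).aemeasurable] at this
  simpa using this

lemma memLp_two (hX : IsZeroMeanGaussianProcess P X) (t : ℝ) : MemLp (X t) 2 P :=
  hX.memLp t 2

lemma integral_sq_sum {r : ℝ → ℝ → ℝ} (hX : IsZeroMeanGaussianProcess P X)
    (hcov : ∀ s t, ∫ ω, X s ω * X t ω ∂P = r s t) (t c : ι → ℝ) :
    ∫ ω, (∑ i, c i * X (t i) ω) ^ 2 ∂P = ∑ i, ∑ j, c i * c j * r (t i) (t j) := by
  have hinteg : ∀ i j, Integrable (fun ω => c i * c j * (X (t i) ω * X (t j) ω)) P := fun i j =>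
    ((hX.memLp_two (t i)).integrable_mul (hX.memLp_two (t j))).const_mul _
  have : ∀ ω, (∑ i, c i * X (t i) ω) ^ 2 = ∑ i, ∑ j, c i * c j * (X (t i) ω * X (t j) ω) := by
    intro ω
    rw [sq, Finset.sum_mul_sum]
    exact Finset.sum_congr rfl fun i _ => Finset.sum_congr rfl fun j _ => by ring
  simp_rw [this]
  rw [integral_finsetSum _ fun i _ => integrable_finsetSum _ fun j _ => hinteg i j]
  refine Finset.sum_congr rfl fun i _ => ?_
  rw [integral_finsetSum _ fun j _ => hinteg i j]
  simp_rw [integral_const_mul, hcov]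

lemma map_sum_eq {r : ℝ → ℝ → ℝ} (hX : IsZeroMeanGaussianProcess P X)
    (hcov : ∀ s t, ∫ ω, X s ω * X t ω ∂P = r s t) (t c : ι → ℝ) :
    P.map (fun ω => ∑ i, c i * X (t i) ω)
      = gaussianReal 0 (∑ i, ∑ j, c i * c j * r (t i) (t j)).toNNReal := by
  obtain ⟨v, hv⟩ := hX.exists_map_sum_eq t c
  have h1 : ∫ x, x ^ 2 ∂(gaussianReal 0 v) = v := by
    have := variance_eq_integral (X := id) (μ := gaussianReal 0 v) aemeasurable_id
    rw [variance_id_gaussianReal] at this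
    simpa using this.symm
  rw [← hv, integral_map (hX.measurable_sum t c).aemeasurable (by fun_prop),
    hX.integral_sq_sum hcov] at h1
  rw [hv, h1, Real.toNNReal_coe]

lemma integral_cexp_sum {r : ℝ → ℝ → ℝ} (hX : IsZeroMeanGaussianProcess P X)
    (hcov : ∀ s t, ∫ ω, X s ω * X t ω ∂P = r s t) (t c : ι → ℝ) :
    ∫ ω, Complex.exp ((∑ i, c i * X (t i) ω : ℝ) * Complex.I) ∂P
      = Complex.exp ((-(∑ i, ∑ j, c i * c j * r (t i) (t j)) / 2 : ℝ)) := by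
  have h := charFun_gaussianReal (μ := 0)
    (v := (∑ i, ∑ j, c i * c j * r (t i) (t j)).toNNReal) 1
  rw [← hX.map_sum_eq hcov, charFun_apply_real,
    integral_map (hX.measurable_sum t c).aemeasurable (by fun_prop)] at h
  have hn : 0 ≤ ∑ i, ∑ j, c i * c j * r (t i) (t j) := by
    rw [← hX.integral_sq_sum hcov]
    exact integral_nonneg fun ω => sq_nonneg _
  have h' : (((∑ i, ∑ j, c i * c j * r (t i) (t j)).toNNReal : ℝ) : ℂ)
      = ((∑ i, ∑ j, c i * c j * r (t i) (t j) : ℝ) : ℂ) := by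
    rw [Real.coe_toNNReal _ hn]
  rw [h'] at h
  simp only [Complex.ofReal_one, one_mul] at h
  rw [h]
  congr 1
  push_cast
  ring

variable {R : ℝ → ℝ}

lemma measurable_residual (hX : IsZeroMeanGaussianProcess P X) (t c : ι → ℝ) :
    Measurable fun ω => ∑ i, c i * (X (t i) ω - R (t i) / R 0 * X 0 ω) := by
  simp_rw [residual_eq]
  exact hX.measurable_sum _ _

lemma residual_variance_eq (hR0 : R 0 ≠ 0) (heven : ∀ t, R (-t) = R t) (t c : ι → ℝ) :
    ∑ o : Option ι, ∑ o' : Option ι, (o.elim (-∑ i, c i * (R (t i) / R 0)) c)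
        * (o'.elim (-∑ i, c i * (R (t i) / R 0)) c) * R (o.elim 0 t - o'.elim 0 t)
      = ∑ i, ∑ j, c i * c j * R (t i - t j) - (∑ i, c i * R (t i)) ^ 2 / R 0 := by
  simp only [Fintype.sum_option, Option.elim, sub_zero, zero_sub, heven, Finset.sum_add_distrib]
  have h1 : ∑ i, c i * (R (t i) / R 0) = (∑ i, c i * R (t i)) / R 0 := by
    rw [Finset.sum_div]; exact Finset.sum_congr rfl fun i _ => by ring
  have h2 : ∀ β, ∑ i, c i * β * R (t i) = β * ∑ i, c i * R (t i) := by
    intro β; rw [Finset.mul_sum]; exact Finset.sum_congr rfl fun i _ => by ring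
  have h3 : ∀ β, ∑ i, β * c i * R (t i) = β * ∑ i, c i * R (t i) := by
    intro β; rw [Finset.mul_sum]; exact Finset.sum_congr rfl fun i _ => by ring
  rw [h1, h2, h3]
  field_simp
  ring

lemma map_residual_eq (hX : IsZeroMeanGaussianProcess P X)
    (hcov : ∀ s t, ∫ ω, X s ω * X t ω ∂P = R (s - t)) (hR0 : R 0 ≠ 0)
    (heven : ∀ t, R (-t) = R t) (t c : ι → ℝ) :
    P.map (fun ω => ∑ i, c i * (X (t i) ω - R (t i) / R 0 * X 0 ω))
      = gaussianReal 0 (∑ i, ∑ j, c i * c j * R (t i - t j)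
        - (∑ i, c i * R (t i)) ^ 2 / R 0).toNNReal := by
  simp_rw [residual_eq]
  rw [hX.map_sum_eq hcov, residual_variance_eq hR0 heven]

lemma indepFun_residual [IsProbabilityMeasure P] (hX : IsZeroMeanGaussianProcess P X)
    (hcov : ∀ s t, ∫ ω, X s ω * X t ω ∂P = R (s - t)) (hR0 : R 0 ≠ 0) (t c : ι → ℝ) :
    IndepFun (fun ω => ∑ i, c i * (X (t i) ω - R (t i) / R 0 * X 0 ω)) (X 0) P := by
  have hm := hX.measurable_residual (R := R) t c
  have hmean : ∀ s, ∫ ω, X s ω ∂P = 0 := by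
    intro s
    obtain ⟨v, hv⟩ := hX.exists_map_eq s
    have := integral_id_gaussianReal (μ := 0) (v := v)
    rwa [← hv, integral_map (hX.1 s).aemeasurable (by fun_prop)] at this
  have hL : HasGaussianLaw (fun ω => (∑ i, c i * (X (t i) ω - R (t i) / R 0 * X 0 ω), X 0 ω)) P := by
    refine ⟨isGaussian_of_map_eq_gaussianReal fun L => ?_⟩
    rw [Measure.map_map (by fun_prop) (hm.prodMk (hX.1 0))]
    obtain ⟨v, hv⟩ := hX.exists_map_sum_eq (ι := Option ι) (fun o => o.elim 0 t)
      (fun o => o.elim (-(L (1, 0) * ∑ i, c i * (R (t i) / R 0)) + L (0, 1))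
        fun i => L (1, 0) * c i)
    refine ⟨0, v, ?_⟩
    rw [← hv]
    congr 1 with ω
    have hLin : ∀ a b, L (a, b) = L (1, 0) * a + L (0, 1) * b := by
      intro a b
      have : ((a, b) : ℝ × ℝ) = a • ((1, 0) : ℝ × ℝ) + b • ((0, 1) : ℝ × ℝ) := by simp
      rw [this, map_add, map_smul, map_smul]; simp [mul_comm]
    simp only [Function.comp]
    rw [hLin, residual_eq, Fintype.sum_option, Fintype.sum_option]
    simp only [Option.elim]
    simp_rw [mul_assoc, ← Finset.mul_sum]
    ring
  refine hL.indepFun_of_covariance_eq_zero ?_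
  have mem := hX.memLp_two
  have memL : MemLp (fun ω => ∑ i, c i * (X (t i) ω - R (t i) / R 0 * X 0 ω)) 2 P :=
    memLp_finsetSum _ fun i _ => ((mem _).sub ((mem 0).const_mul _)).const_mul _
  rw [covariance_eq_sub memL (mem 0), hmean 0, mul_zero, sub_zero]
  simp only [Pi.mul_apply, Finset.sum_mul]
  have hinteg : ∀ i, Integrable (fun ω => X (t i) ω * X 0 ω) P := fun i =>
    (mem _).integrable_mul (mem 0)
  have hinteg0 : Integrable (fun ω => X 0 ω * X 0 ω) P := (mem 0).integrable_mul (mem 0)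
  have hrw : ∀ i ω, c i * (X (t i) ω - R (t i) / R 0 * X 0 ω) * X 0 ω
      = c i * (X (t i) ω * X 0 ω - R (t i) / R 0 * (X 0 ω * X 0 ω)) := fun i ω => by ring
  simp_rw [hrw]
  have hinteg' : ∀ i, Integrable
      (fun ω => c i * (X (t i) ω * X 0 ω - R (t i) / R 0 * (X 0 ω * X 0 ω))) P :=
    fun i => ((hinteg i).sub (hinteg0.const_mul _)).const_mul _
  rw [integral_finsetSum _ fun i _ => hinteg' i]
  refine Finset.sum_eq_zero fun i _ => ?_
  rw [integral_const_mul, integral_sub (hinteg i) (hinteg0.const_mul _), integral_const_mul,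
    hcov, hcov]
  rw [sub_zero, sub_zero, div_mul_cancel₀ _ hR0, sub_self, mul_zero]

end IsZeroMeanGaussianProcess

section GaussianExcess

open Real Set

variable {Ω : Type*} [MeasurableSpace Ω] {P : Measure Ω} {Y : Ω → ℝ} {v : NNReal}

lemma integral_cond_mul_of_indepFun [IsFiniteMeasure P] {L : Ω → ℝ} (h : IndepFun L Y P)
    (hL : Measurable L) (hY : Measurable Y) {s : Set ℝ} (hs : MeasurableSet s)
    {f g : ℝ → ℂ} (hf : Measurable f) (hg : Measurable g) :
    ∫ ω, f (L ω) * g (Y ω) ∂(P[|Y ⁻¹' s])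
      = (∫ ω, f (L ω) ∂P) * ∫ ω, g (Y ω) ∂(P[|Y ⁻¹' s]) := by
  have hind : ∀ φ : Ω → ℂ, ∫ ω, φ ω ∂(P[|Y ⁻¹' s])
      = (P (Y ⁻¹' s))⁻¹.toReal • ∫ ω, (Y ⁻¹' s).indicator φ ω ∂P := fun φ => by
    rw [ProbabilityTheory.cond, integral_smul_measure, integral_indicator (hY hs)]
  rw [hind, hind]
  have h1 : ∀ ω, (Y ⁻¹' s).indicator (fun ω => f (L ω) * g (Y ω)) ω
      = f (L ω) * s.indicator g (Y ω) := fun ω => by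
    by_cases hω : Y ω ∈ s <;> simp [indicator, hω]
  have h2 : ∀ ω, (Y ⁻¹' s).indicator (fun ω => g (Y ω)) ω = s.indicator g (Y ω) := fun ω => by
    by_cases hω : Y ω ∈ s <;> simp [indicator, hω]
  simp_rw [h1, h2]
  rw [h.integral_fun_comp_mul_comp hL.aemeasurable hY.aemeasurable hf.aestronglyMeasurable
    (hg.indicator hs).aestronglyMeasurable, mul_smul_comm]

lemma cond_preimage_of_indepFun [IsFiniteMeasure P] {L : Ω → ℝ} (h : IndepFun L Y P)
    (hY : Measurable Y) {s : Set ℝ} (hs : MeasurableSet s) (h0 : P (Y ⁻¹' s) ≠ 0)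
    {E : Set ℝ} (hE : MeasurableSet E) : P[|Y ⁻¹' s] (L ⁻¹' E) = P (L ⁻¹' E) := by
  rw [cond_apply (hY hs), inter_comm, h.measure_inter_preimage_eq_mul _ _ hE hs, mul_comm (P _),
    ← mul_assoc, ENNReal.inv_mul_cancel h0 (measure_ne_top _ _), one_mul]

lemma measure_gaussian_Ioi_ne_zero (hv : v ≠ 0) (hY : Measurable Y)
    (hlaw : P.map Y = gaussianReal 0 v) (u : ℝ) : P (Y ⁻¹' Ioi u) ≠ 0 := by
  rw [← Measure.map_apply hY measurableSet_Ioi, hlaw]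
  intro h
  have := gaussianReal_absolutelyContinuous' 0 hv h
  simp at this

lemma setIntegral_gaussian_excess {E : Type*} [NormedAddCommGroup E] [NormedSpace ℝ E]
    (hv : v ≠ 0) (hY : Measurable Y) (hlaw : P.map Y = gaussianReal 0 v) {u : ℝ} (hu : 0 < u)
    {g : ℝ → E} (hg : StronglyMeasurable g) :
    ∫ ω in Y ⁻¹' Ioi u, g (u * (Y ω - u)) ∂P
      = ((√(2 * π * v))⁻¹ * exp (-u ^ 2 / (2 * v)) * u⁻¹) •
        ∫ y in Ioi 0, exp (-(y / v) - y ^ 2 / (2 * u ^ 2 * v)) • g y := by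
  have hv0 : (v : ℝ) ≠ 0 := by exact_mod_cast hv
  have hgm : StronglyMeasurable fun x => g (u * (x - u)) :=
    hg.comp_measurable (by fun_prop)
  rw [← setIntegral_map (f := fun x => g (u * (x - u))) measurableSet_Ioi
    hgm.aestronglyMeasurable hY.aemeasurable, hlaw, ← integral_indicator measurableSet_Ioi,
    integral_gaussianReal_eq_integral_smul hv, ← integral_add_right_eq_self _ u]
  have h1 : ∀ x, gaussianPDFReal 0 v (x + u) •
      (Ioi u).indicator (fun x => g (u * (x - u))) (x + u)
      = (Ioi 0).indicator (fun x => ((√(2 * π * v))⁻¹ * exp (-u ^ 2 / (2 * v))) •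
        (exp (-((u * x) / v) - (u * x) ^ 2 / (2 * u ^ 2 * v)) • g (u * x))) x := by
    intro x
    by_cases hx : 0 < x
    · rw [indicator_of_mem (by simpa using hx), indicator_of_mem (by simpa using hx), smul_smul,
        mul_assoc, ← exp_add, gaussianPDFReal, add_sub_cancel_right]
      congr 3
      field_simp
      ring
    · rw [indicator_of_notMem (by simpa using hx), indicator_of_notMem (by simpa using hx),
        smul_zero]
  simp_rw [h1]
  rw [integral_indicator measurableSet_Ioi, integral_smul,
    integral_comp_mul_left_Ioi (fun y => exp (-(y / v) - y ^ 2 / (2 * u ^ 2 * v)) • g y) 0 hu,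
    mul_zero, smul_smul]

lemma integral_cond_gaussian_excess {E : Type*} [NormedAddCommGroup E] [NormedSpace ℝ E]
    [IsProbabilityMeasure P] (hv : v ≠ 0) (hY : Measurable Y)
    (hlaw : P.map Y = gaussianReal 0 v) {u : ℝ} (hu : 0 < u)
    {g : ℝ → E} (hg : StronglyMeasurable g) :
    ∫ ω, g (u * (Y ω - u)) ∂(P[|Y ⁻¹' Ioi u])
      = (∫ y in Ioi 0, exp (-(y / v) - y ^ 2 / (2 * u ^ 2 * v)))⁻¹ •
        ∫ y in Ioi 0, exp (-(y / v) - y ^ 2 / (2 * u ^ 2 * v)) • g y := by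
  have hv0 : (0 : ℝ) < v := by exact_mod_cast pos_iff_ne_zero.2 hv
  have h1 := setIntegral_gaussian_excess hv hY hlaw hu (g := fun _ => (1 : ℝ))
    stronglyMeasurable_const
  simp only [smul_eq_mul, mul_one, setIntegral_const] at h1
  rw [ProbabilityTheory.cond, integral_smul_measure, setIntegral_gaussian_excess hv hY hlaw hu hg,
    ENNReal.toReal_inv, ← Measure.real, h1, smul_smul]
  congr 1
  have hK : (√(2 * π * v))⁻¹ * exp (-u ^ 2 / (2 * v)) * u⁻¹ ≠ 0 := by positivity
  rw [mul_inv, mul_right_comm, inv_mul_cancel₀ hK, one_mul]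

lemma integrableOn_exp_neg_div {r : ℝ} (hr : 0 < r) :
    IntegrableOn (fun y : ℝ => exp (-(y / r))) (Ioi 0) := by
  have := integrableOn_exp_mul_Ioi (a := -r⁻¹) (by simpa using hr) 0
  exact this.congr_fun (fun y _ => by simp only [neg_mul, div_eq_inv_mul]) measurableSet_Ioi

lemma integral_exp_neg_div {r : ℝ} (hr : 0 < r) :
    ∫ y in Ioi (0 : ℝ), exp (-(y / r)) = r := by
  have := integral_exp_mul_Ioi (a := -r⁻¹) (by simpa using hr) 0
  simp only [mul_zero, exp_zero, neg_div_neg_eq, one_div, inv_inv] at this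
  refine Eq.trans (integral_congr_ae (Eventually.of_forall fun y => ?_)) this
  simp only [neg_mul, div_eq_inv_mul]

lemma tendsto_integral_cond_gaussian_excess {E ι : Type*} [NormedAddCommGroup E]
    [NormedSpace ℝ E] [IsProbabilityMeasure P] (hv : v ≠ 0) (hY : Measurable Y)
    (hlaw : P.map Y = gaussianReal 0 v) {l : Filter ι} [l.IsCountablyGenerated]
    {u : ι → ℝ} (hu : Tendsto u l atTop) {g : ι → ℝ → E} {g₀ : ℝ → E} {G : ℝ → ℝ}
    (hg : ∀ i, StronglyMeasurable (g i)) (hgG : ∀ i, ∀ y > 0, ‖g i y‖ ≤ G y)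
    (hG : IntegrableOn (fun y => exp (-(y / v)) * G y) (Ioi 0))
    (hlim : ∀ y > 0, Tendsto (fun i => g i y) l (nhds (g₀ y))) :
    Tendsto (fun i => ∫ ω, g i (u i * (Y ω - u i)) ∂(P[|Y ⁻¹' Ioi (u i)])) l
      (nhds ((v : ℝ)⁻¹ • ∫ y in Ioi 0, exp (-(y / v)) • g₀ y)) := by
  have hv0 : (0 : ℝ) < v := by exact_mod_cast pos_iff_ne_zero.2 hv
  have hw : ∀ y : ℝ, Tendsto (fun i => exp (-(y / v) - y ^ 2 / (2 * u i ^ 2 * v))) l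
      (nhds (exp (-(y / v)))) := by
    intro y
    have h2 : Tendsto (fun i => 2 * u i ^ 2 * v) l atTop :=
      (((tendsto_pow_atTop two_ne_zero).comp hu).const_mul_atTop two_pos).atTop_mul_const hv0
    have := (tendsto_const_nhds (x := y ^ 2)).div_atTop h2
    have := (Real.continuous_exp.tendsto _).comp (this.const_sub (-(y / v)))
    rwa [sub_zero] at this
  have hle : ∀ i (y : ℝ), exp (-(y / v) - y ^ 2 / (2 * u i ^ 2 * v)) ≤ exp (-(y / v)) :=
    fun i y => exp_le_exp.2 (sub_le_self _ (by positivity))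
  have hden : Tendsto (fun i => ∫ y in Ioi (0 : ℝ), exp (-(y / v) - y ^ 2 / (2 * u i ^ 2 * v))) l
      (nhds (v : ℝ)) := by
    suffices h : Tendsto (fun i => ∫ y in Ioi (0 : ℝ), exp (-(y / v) - y ^ 2 / (2 * u i ^ 2 * v)))
        l (nhds (∫ y in Ioi (0 : ℝ), exp (-(y / v)))) by rwa [integral_exp_neg_div hv0] at h
    refine tendsto_integral_filter_of_dominated_convergence _
      (Eventually.of_forall fun i => by fun_prop)
      (Eventually.of_forall fun i => Eventually.of_forall fun y => ?_)
      (integrableOn_exp_neg_div hv0) (Eventually.of_forall hw)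
    rw [Real.norm_of_nonneg (exp_nonneg _)]
    exact hle i y
  have hnum : Tendsto (fun i => ∫ y in Ioi (0 : ℝ),
      exp (-(y / v) - y ^ 2 / (2 * u i ^ 2 * v)) • g i y) l
      (nhds (∫ y in Ioi 0, exp (-(y / v)) • g₀ y)) := by
    refine tendsto_integral_filter_of_dominated_convergence _
      (Eventually.of_forall fun i => ?_)
      (Eventually.of_forall fun i => (ae_restrict_iff' measurableSet_Ioi).2
        (Eventually.of_forall fun y hy => ?_)) hG
      ((ae_restrict_iff' measurableSet_Ioi).2 (Eventually.of_forall fun y hy => ?_))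
    · have : Measurable fun y : ℝ => exp (-(y / v) - y ^ 2 / (2 * u i ^ 2 * v)) := by fun_prop
      exact (this.stronglyMeasurable.smul (hg i)).aestronglyMeasurable
    · rw [norm_smul, Real.norm_of_nonneg (exp_nonneg _)]
      exact mul_le_mul (hle i y) (hgG i y hy) (norm_nonneg _) (exp_nonneg _)
    · exact (hw y).smul (hlim y hy)
  refine ((hden.inv₀ hv0.ne').smul hnum).congr' ?_
  filter_upwards [hu.eventually_gt_atTop 0] with i hi
  rw [integral_cond_gaussian_excess hv hY hlaw hi (hg i)]

lemma integrableOn_exp_neg_div_mul_one_add_pow {r : ℝ} (hr : 0 < r) (p : ℕ) :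
    IntegrableOn (fun y : ℝ => exp (-(y / r)) * (1 + y) ^ p) (Ioi 0) := by
  have h1 := (integrableOn_rpow_mul_exp_neg_mul_rpow (p := 1) (s := p) (b := r⁻¹)
    (lt_of_lt_of_le (by norm_num) p.cast_nonneg) one_pos (by positivity)).add
    (integrableOn_exp_neg_div hr)
  refine Integrable.mono' (h1.const_mul (2 ^ (p - 1))) (by fun_prop) ?_
  refine (ae_restrict_iff' measurableSet_Ioi).2 (Eventually.of_forall fun y hy => ?_)
  have hy : 0 < y := hy
  have h2 := add_pow_le zero_le_one hy.le p
  rw [Real.norm_of_nonneg (by positivity)]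
  have h3 : exp (-r⁻¹ * y ^ (1 : ℝ)) = exp (-(y / r)) := by
    rw [rpow_one]; congr 1; ring
  simp only [Pi.add_apply, h3, rpow_natCast]
  calc _ ≤ exp (-(y / r)) * (2 ^ (p - 1) * (1 ^ p + y ^ p)) := by gcongr
    _ = _ := by rw [one_pow]; ring

lemma integral_comp_exponential {Q : Measure Ω} [IsProbabilityMeasure Q] {T : Ω → ℝ}
    (hT : Measurable T) (hexp : ∀ x : ℝ, 0 ≤ x → Q {ω | x < T ω} = ENNReal.ofReal (exp (-x)))
    {r : ℝ} (hr : 0 < r) {E : Type*} [NormedAddCommGroup E] [NormedSpace ℝ E] {f : ℝ → E}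
    (hf : StronglyMeasurable f) :
    ∫ ω, f (r * T ω) ∂Q = r⁻¹ • ∫ y in Ioi 0, exp (-(y / r)) • f y := by
  have : IsProbabilityMeasure (Q.map T) := Measure.isProbabilityMeasure_map hT.aemeasurable
  have : IsProbabilityMeasure (expMeasure 1) := isProbabilityMeasure_expMeasure one_pos
  have hpos : ∀ x : ℝ, 0 ≤ x → Q.real {ω | T ω ≤ x} = 1 - exp (-x) := by
    intro x hx
    have hc : {ω | T ω ≤ x} = {ω | x < T ω}ᶜ := by ext; simp
    rw [hc, probReal_compl_eq_one_sub (measurableSet_lt measurable_const hT), Measure.real,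
      hexp x hx, ENNReal.toReal_ofReal (exp_nonneg _)]
  have hlaw : Q.map T = expMeasure 1 := by
    refine Measure.eq_of_cdf _ _ (StieltjesFunction.ext fun x => ?_)
    rw [cdf_expMeasure_eq one_pos, cdf_eq_real, measureReal_def,
      Measure.map_apply hT measurableSet_Iic]
    change Q.real {ω | T ω ≤ x} = _
    split_ifs with hx
    · rw [hpos x hx, one_mul]
    · have h0 := hpos 0 le_rfl
      rw [neg_zero, exp_zero, sub_self] at h0
      refine le_antisymm (h0 ▸ measureReal_mono fun ω hω => ?_) measureReal_nonneg
      exact le_trans (b := x) hω (not_le.1 hx).le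
  have hfr : StronglyMeasurable fun x => f (r * x) := hf.comp_measurable (by fun_prop)
  rw [← integral_map (f := fun x => f (r * x)) hT.aemeasurable hfr.aestronglyMeasurable, hlaw]
  have hm : Measurable (exponentialPDF 1) := (measurable_exponentialPDFReal 1).ennreal_ofReal
  change ∫ x, f (r * x) ∂(volume.withDensity (exponentialPDF 1)) = _
  rw [integral_withDensity_eq_integral_toReal_smul hm
    (Eventually.of_forall fun x => by simp [exponentialPDF_eq])]
  have h1 : ∀ x, (exponentialPDF 1 x).toReal • f (r * x)
      = (Ici 0).indicator (fun x => exp (-(r * x / r)) • f (r * x)) x := by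
    intro x
    rw [exponentialPDF_eq]
    by_cases hx : 0 ≤ x
    · rw [indicator_of_mem (by simpa using hx), if_pos hx, one_mul, one_mul,
        mul_div_cancel_left₀ _ hr.ne', ENNReal.toReal_ofReal (exp_nonneg _)]
    · rw [indicator_of_notMem (by simpa using hx), if_neg hx]; simp
  simp_rw [h1]
  rw [integral_indicator measurableSet_Ici, integral_Ici_eq_integral_Ioi,
    integral_comp_mul_left_Ioi (fun y => exp (-(y / r)) • f y) 0 hr, mul_zero]

end GaussianExcess

namespace IsZeroMeanGaussianProcess

open Real Set

variable {Ω : Type*} [MeasurableSpace Ω] {P : Measure Ω} {X : ℝ → Ω → ℝ}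
  {ι : Type} [Fintype ι] {R : ℝ → ℝ}

lemma residual_variance_nonneg (hX : IsZeroMeanGaussianProcess P X)
    (hcov : ∀ s t, ∫ ω, X s ω * X t ω ∂P = R (s - t)) (hR0 : R 0 ≠ 0)
    (heven : ∀ t, R (-t) = R t) (t c : ι → ℝ) :
    0 ≤ ∑ i, ∑ j, c i * c j * R (t i - t j) - (∑ i, c i * R (t i)) ^ 2 / R 0 := by
  rw [← residual_variance_eq hR0 heven, ← hX.integral_sq_sum hcov]
  exact integral_nonneg fun ω => sq_nonneg _

lemma integral_cexp_residual (hX : IsZeroMeanGaussianProcess P X)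
    (hcov : ∀ s t, ∫ ω, X s ω * X t ω ∂P = R (s - t)) (hR0 : R 0 ≠ 0)
    (heven : ∀ t, R (-t) = R t) (t c : ι → ℝ) (u : ℝ) :
    ∫ ω, Complex.exp (((u * ∑ i, c i * (X (t i) ω - R (t i) / R 0 * X 0 ω) : ℝ) : ℂ) * Complex.I) ∂P
      = Complex.exp ((-(u ^ 2 * (∑ i, ∑ j, c i * c j * R (t i - t j)
        - (∑ i, c i * R (t i)) ^ 2 / R 0)) / 2 : ℝ)) := by
  have h := charFun_gaussianReal (μ := 0) (v := (∑ i, ∑ j, c i * c j * R (t i - t j)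
        - (∑ i, c i * R (t i)) ^ 2 / R 0).toNNReal) u
  have h' := Real.coe_toNNReal _ (hX.residual_variance_nonneg hcov hR0 heven t c)
  rw [← hX.map_residual_eq hcov hR0 heven, charFun_apply_real,
    integral_map (hX.measurable_residual t c).aemeasurable (by fun_prop), h'] at h
  simp_rw [Complex.ofReal_mul]
  rw [h]
  congr 1
  push_cast
  ring

lemma residual_variance_eq_sub (hR0 : R 0 ≠ 0) (t c : ι → ℝ) :
    ∑ i, ∑ j, c i * c j * R (t i - t j) - (∑ i, c i * R (t i)) ^ 2 / R 0
      = 2 * (∑ i, c i) * (∑ i, c i * (R 0 - R (t i)))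
        - ∑ i, ∑ j, c i * c j * (R 0 - R (t i - t j))
        - (∑ i, c i * (R 0 - R (t i))) ^ 2 / R 0 := by
  have h1 : ∑ i, c i * (R 0 - R (t i)) = (∑ i, c i) * R 0 - ∑ i, c i * R (t i) := by
    simp_rw [mul_sub, Finset.sum_sub_distrib, ← Finset.sum_mul]
  have h2 : ∑ i, ∑ j, c i * c j * (R 0 - R (t i - t j))
      = (∑ i, c i) ^ 2 * R 0 - ∑ i, ∑ j, c i * c j * R (t i - t j) := by
    simp_rw [mul_sub, Finset.sum_sub_distrib, ← Finset.sum_mul]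
    rw [sq, Finset.sum_mul_sum]
  rw [h1, h2]
  field_simp
  ring

lemma tendsto_integral_cexp_excess [IsProbabilityMeasure P] (hX : IsZeroMeanGaussianProcess P X)
    (hcov : ∀ s t, ∫ ω, X s ω * X t ω ∂P = R (s - t)) (hR0 : 0 < R 0)
    (heven : ∀ t, R (-t) = R t) {κ : Type*} {l : Filter κ} [l.IsCountablyGenerated]
    {u δ : κ → ℝ} (hu : Tendsto u l atTop) {ψ : ℝ → ℝ}
    (hψ : ∀ t, Tendsto (fun n => u n ^ 2 * (R 0 - R (t * δ n))) l (nhds (ψ t))) (t c : ι → ℝ) :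
    Tendsto (fun n => ∫ ω, Complex.exp
        (((∑ i, c i * (u n * (X (t i * δ n) ω - u n)) : ℝ) : ℂ) * Complex.I)
        ∂(P[|X 0 ⁻¹' Ioi (u n)])) l
      (nhds (Complex.exp ((-(2 * (∑ i, c i) * (∑ i, c i * ψ (t i))
          - ∑ i, ∑ j, c i * c j * ψ (t i - t j)) / 2 : ℝ))
        * ((R 0)⁻¹ • ∫ y in Ioi 0, exp (-(y / R 0)) •
          Complex.exp ((((∑ i, c i) * y - (∑ i, c i * ψ (t i)) / R 0 : ℝ) : ℂ) * Complex.I)))) := by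
  set w : κ → ℝ := fun n => ∑ i, c i * (u n ^ 2 * (R 0 - R (t i * δ n)))
  set b : κ → ℝ := fun n => ∑ i, c i * (R (t i * δ n) / R 0)
  have hw : Tendsto w l (nhds (∑ i, c i * ψ (t i))) :=
    tendsto_finsetSum _ fun i _ => (hψ (t i)).const_mul (c i)
  have hu2 : Tendsto (fun n => (u n ^ 2)⁻¹) l (nhds 0) :=
    ((tendsto_pow_atTop two_ne_zero).comp hu).inv_tendsto_atTop
  have hb : Tendsto b l (nhds (∑ i, c i)) := by
    have h1 := ((hw.mul hu2).div_const (R 0)).const_sub (∑ i, c i)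
    rw [mul_zero, zero_div, sub_zero] at h1
    refine h1.congr' ?_
    filter_upwards [hu.eventually_gt_atTop 0] with n hn
    simp only [w, b]
    rw [Finset.sum_mul, Finset.sum_div, ← Finset.sum_sub_distrib]
    refine Finset.sum_congr rfl fun i _ => ?_
    field_simp
    ring
  have hlaw : P.map (X 0) = gaussianReal 0 (R 0).toNNReal := by
    have := hX.map_sum_eq hcov (ι := Unit) (fun _ => 0) (fun _ => 1)
    simpa using this
  have hv : (R 0).toNNReal ≠ 0 := by simpa using hR0
  have hvR : (((R 0).toNNReal : NNReal) : ℝ) = R 0 := Real.coe_toNNReal _ hR0.le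
  have hfac : ∀ n, ∫ ω, Complex.exp
        (((∑ i, c i * (u n * (X (t i * δ n) ω - u n)) : ℝ) : ℂ) * Complex.I)
        ∂(P[|X 0 ⁻¹' Ioi (u n)])
      = Complex.exp ((-(u n ^ 2 * (∑ i, ∑ j, c i * c j * R (t i * δ n - t j * δ n)
        - (∑ i, c i * R (t i * δ n)) ^ 2 / R 0)) / 2 : ℝ))
        * ∫ ω, Complex.exp (((b n * (u n * (X 0 ω - u n)) - w n / R 0 : ℝ) : ℂ) * Complex.I)
          ∂(P[|X 0 ⁻¹' Ioi (u n)]) := by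
    intro n
    have hf : Measurable fun x : ℝ => Complex.exp (((u n * x : ℝ) : ℂ) * Complex.I) := by fun_prop
    have hg : Measurable fun x : ℝ =>
      Complex.exp (((b n * (u n * (x - u n)) - w n / R 0 : ℝ) : ℂ) * Complex.I) := by fun_prop
    have hmul := integral_cond_mul_of_indepFun
      (hX.indepFun_residual hcov hR0.ne' (fun i => t i * δ n) c) (hX.measurable_residual _ c)
      (hX.1 0) (measurableSet_Ioi (a := u n)) hf hg
    rw [hX.integral_cexp_residual hcov hR0.ne' heven] at hmul
    rw [← hmul]
    refine integral_congr_ae (Eventually.of_forall fun ω => ?_)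
    simp only
    rw [← Complex.exp_add, ← add_mul, ← Complex.ofReal_add]
    congr 3
    simp only [w, b]
    rw [Finset.mul_sum, Finset.sum_mul, Finset.sum_div, ← Finset.sum_sub_distrib,
      ← Finset.sum_add_distrib]
    refine Finset.sum_congr rfl fun i _ => ?_
    field_simp
    ring
  simp_rw [hfac]
  refine Tendsto.mul ?_ ?_
  · have hww : Tendsto (fun n => ∑ i, ∑ j, c i * c j * (u n ^ 2 * (R 0 - R ((t i - t j) * δ n)))) l
        (nhds (∑ i, ∑ j, c i * c j * ψ (t i - t j))) :=
      tendsto_finsetSum _ fun i _ => tendsto_finsetSum _ fun j _ => (hψ _).const_mul _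
    have h1 : Tendsto (fun n => -(2 * (∑ i, c i) * w n
        - ∑ i, ∑ j, c i * c j * (u n ^ 2 * (R 0 - R ((t i - t j) * δ n)))
        - w n ^ 2 * (u n ^ 2)⁻¹ / R 0) / 2) l (nhds (-(2 * (∑ i, c i) * (∑ i, c i * ψ (t i))
          - ∑ i, ∑ j, c i * c j * ψ (t i - t j)) / 2)) := by
      have := ((((hw.const_mul (2 * ∑ i, c i)).sub hww).sub
        (((hw.pow 2).mul hu2).div_const (R 0))).neg).div_const 2
      simpa only [mul_zero, zero_div, sub_zero] using this
    refine (Complex.continuous_exp.tendsto _).comp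
      ((Complex.continuous_ofReal.tendsto _).comp (h1.congr' ?_))
    filter_upwards [hu.eventually_gt_atTop 0] with n hn
    rw [residual_variance_eq_sub hR0.ne']
    have e1 : w n = u n ^ 2 * ∑ i, c i * (R 0 - R (t i * δ n)) := by
      rw [Finset.mul_sum]; exact Finset.sum_congr rfl fun i _ => by ring
    have e2 : ∑ i, ∑ j, c i * c j * (u n ^ 2 * (R 0 - R ((t i - t j) * δ n)))
        = u n ^ 2 * ∑ i, ∑ j, c i * c j * (R 0 - R (t i * δ n - t j * δ n)) := by
      simp_rw [Finset.mul_sum, ← sub_mul]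
      exact Finset.sum_congr rfl fun i _ => Finset.sum_congr rfl fun j _ => by ring
    rw [e1, e2]
    generalize ∑ i, c i * (R 0 - R (t i * δ n)) = a
    generalize ∑ i, ∑ j, c i * c j * (R 0 - R (t i * δ n - t j * δ n)) = a'
    field_simp
  · have := tendsto_integral_cond_gaussian_excess hv (hX.1 0) hlaw hu (G := fun _ => 1)
      (g := fun n y => Complex.exp (((b n * y - w n / R 0 : ℝ) : ℂ) * Complex.I))
      (g₀ := fun y => Complex.exp ((((∑ i, c i) * y - (∑ i, c i * ψ (t i)) / R 0 : ℝ) : ℂ)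
        * Complex.I))
      (fun n => Measurable.stronglyMeasurable (by fun_prop))
      (fun n y _ => (Complex.norm_exp_ofReal_mul_I _).le)
      (by simpa [hvR] using integrableOn_exp_neg_div hR0)
      (fun y _ => (Complex.continuous_exp.tendsto _).comp
        (((Complex.continuous_ofReal.tendsto _).comp
          ((hb.mul_const y).sub (hw.div_const (R 0)))).mul_const _))
    rwa [hvR] at this

/-- The characteristic function of a linear combination of values of a drifted fractional
Brownian motion shifted by an independent exponential variable. -/
lemma integral_cexp_fractional_add_exponential {Q : Measure Ω} [IsProbabilityMeasure Q]
    {B : ℝ → Ω → ℝ} {T : Ω → ℝ} {α : ℝ} (hB : IsZeroMeanGaussianProcess Q B)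
    (hcov : ∀ s t : ℝ, ∫ ω, B s ω * B t ω ∂Q = (|t| ^ α + |s| ^ α - |t - s| ^ α) / 2)
    (hT : Measurable T) (hexp : ∀ x : ℝ, 0 ≤ x → Q {ω | x < T ω} = ENNReal.ofReal (exp (-x)))
    (hind : ∀ (n : ℕ) (t : Fin n → ℝ), IndepFun (fun ω i => B (t i) ω) T Q)
    {C r : ℝ} (hC : 0 ≤ C) (hr : 0 < r) (t c : ι → ℝ) :
    ∫ ω, Complex.exp (((∑ i, c i * (√(2 * C) * B (t i) ω + r * T ω - C / r * |t i| ^ α) : ℝ) : ℂ)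
        * Complex.I) ∂Q
      = Complex.exp ((-(2 * (∑ i, c i) * (∑ i, c i * (C * |t i| ^ α))
          - ∑ i, ∑ j, c i * c j * (C * |t i - t j| ^ α)) / 2 : ℝ))
        * (r⁻¹ • ∫ y in Ioi 0, exp (-(y / r)) •
          Complex.exp ((((∑ i, c i) * y - (∑ i, c i * (C * |t i| ^ α)) / r : ℝ) : ℂ)
            * Complex.I)) := by
  have hindep : IndepFun (fun ω => ∑ i, (√(2 * C) * c i) * B (t i) ω) T Q := by
    let e := Fintype.equivFin ι
    have h1 := (hind (Fintype.card ι) (t ∘ e.symm)).comp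
      (φ := fun x : Fin (Fintype.card ι) → ℝ => ∑ i, √(2 * C) * c (e.symm i) * x i)
      (ψ := id) (by fun_prop) measurable_id
    refine h1.congr (Eventually.of_forall fun ω => ?_) (Eventually.of_forall fun ω => rfl)
    exact (Equiv.sum_comp e.symm fun i => √(2 * C) * c i * B (t i) ω)
  have hmul := IndepFun.integral_fun_comp_mul_comp (𝕜 := ℂ) (μ := Q)
    (X := fun ω => ∑ i, (√(2 * C) * c i) * B (t i) ω) (Y := T)
    (f := fun x => Complex.exp ((x : ℂ) * Complex.I))
    (g := fun y => Complex.exp ((((∑ i, c i) * (r * y) - (∑ i, c i * (C * |t i| ^ α)) / r : ℝ) : ℂ)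
            * Complex.I)) hindep (hB.measurable_sum t fun i => √(2 * C) * c i).aemeasurable hT.aemeasurable
    (by fun_prop) (by fun_prop)
  rw [hB.integral_cexp_sum hcov, integral_comp_exponential hT hexp hr (f := fun y =>
    Complex.exp ((((∑ i, c i) * y - (∑ i, c i * (C * |t i| ^ α)) / r : ℝ) : ℂ) * Complex.I))
    (Measurable.stronglyMeasurable (by fun_prop))] at hmul
  convert hmul using 1
  · refine integral_congr_ae (Eventually.of_forall fun ω => ?_)
    simp only
    rw [← Complex.exp_add, ← add_mul, ← Complex.ofReal_add]
    congr 3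
    rw [Finset.sum_mul, Finset.sum_div, ← Finset.sum_sub_distrib, ← Finset.sum_add_distrib]
    exact Finset.sum_congr rfl fun i _ => by ring
  · congr 4
    have hs : √(2 * C) * √(2 * C) = 2 * C := Real.mul_self_sqrt (by positivity)
    have e1 : ∀ i j, √(2 * C) * c i * (√(2 * C) * c j)
        * ((|t j| ^ α + |t i| ^ α - |t j - t i| ^ α) / 2)
        = c i * (c j * (C * |t j| ^ α)) + c i * (C * |t i| ^ α) * c j
          - c i * c j * (C * |t i - t j| ^ α) := by
      intro i j
      rw [abs_sub_comm (t j), show ∀ a b d : ℝ, √(2 * C) * a * (√(2 * C) * b) * (d / 2)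
        = (√(2 * C) * √(2 * C)) * (a * b * d / 2) from fun a b d => by ring, hs]
      ring
    simp_rw [e1, Finset.sum_sub_distrib, Finset.sum_add_distrib, ← Finset.mul_sum, ← Finset.sum_mul]
    ring

end IsZeroMeanGaussianProcess

section Markov

open Real Set

lemma measureReal_lt_abs_le_integral_pow {Ω : Type*} [MeasurableSpace Ω] {P : Measure Ω}
    [IsFiniteMeasure P] {f : Ω → ℝ} {q : ℕ} (hf : Integrable (fun ω => f ω ^ (2 * q)) P)
    {a : ℝ} (ha : 0 < a) :
    P.real {ω | a < |f ω|} ≤ (∫ ω, f ω ^ (2 * q) ∂P) / a ^ (2 * q) := by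
  have h := mul_meas_ge_le_integral_of_nonneg
    (Eventually.of_forall fun ω => (even_two_mul q).pow_nonneg (f ω)) hf (a ^ (2 * q))
  rw [le_div_iff₀' (by positivity)]
  refine le_trans (mul_le_mul_of_nonneg_left (measureReal_mono fun ω hω => ?_) (by positivity)) h
  have hω : a < |f ω| := hω
  simpa [(even_two_mul q).pow_abs] using pow_le_pow_left₀ ha.le hω.le (2 * q)

lemma gaussianReal_real_lt_abs_mul_le (w : NNReal) (u : ℝ) (q : ℕ) {a : ℝ} (ha : 0 < a) :
    (gaussianReal 0 w).real {x | a < |u * x|}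
      ≤ (u ^ 2 * w) ^ q * (∫ x, x ^ (2 * q) ∂(gaussianReal 0 1)) / a ^ (2 * q) := by
  have hlaw : gaussianReal 0 w = (gaussianReal 0 1).map (√w * ·) := by
    rw [gaussianReal_map_const_mul, mul_zero]
    congr 1
    ext
    simp [Real.sq_sqrt w.coe_nonneg]
  have hset : MeasurableSet {x : ℝ | a < |u * x|} := measurableSet_lt (by fun_prop) (by fun_prop)
  rw [hlaw, map_measureReal_apply (by fun_prop) hset]
  have hinteg : Integrable (fun x : ℝ => (u * (√w * x)) ^ (2 * q)) (gaussianReal 0 1) := by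
    have := (memLp_id_gaussianReal (μ := 0) (v := 1) (2 * q : ℕ)).integrable_norm_pow'
    simp only [← mul_assoc, mul_pow _ _ (2 * q)]
    refine Integrable.const_mul ?_ _
    simpa [(even_two_mul q).pow_abs] using this
  refine (measureReal_lt_abs_le_integral_pow hinteg ha).trans_eq ?_
  simp only [← mul_assoc, mul_pow _ _ (2 * q)]
  rw [integral_const_mul, ← mul_pow, pow_mul (u * √w), mul_pow u, Real.sq_sqrt w.coe_nonneg]

end Markov

namespace IsZeroMeanGaussianProcess

open Real Set

variable {Ω : Type*} [MeasurableSpace Ω] {P : Measure Ω} {X : ℝ → Ω → ℝ} {R : ℝ → ℝ}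

lemma measureReal_residual_increment_le (hX : IsZeroMeanGaussianProcess P X)
    (hcov : ∀ s t, ∫ ω, X s ω * X t ω ∂P = R (s - t)) (hR0 : 0 < R 0)
    (heven : ∀ t, R (-t) = R t) (s t u : ℝ) {a ε : ℝ} (hε : 0 < ε)
    (ha : u ^ 2 * (R 0 - R (s - t)) ≤ a) (ha0 : 0 ≤ a) (q : ℕ) :
    P.real {ω | ε < |u * ∑ i : Fin 2, ![1, -1] i *
        (X (![s, t] i) ω - R (![s, t] i) / R 0 * X 0 ω)|}
      ≤ (2 * a) ^ q * (∫ x, x ^ (2 * q) ∂(gaussianReal 0 1)) / ε ^ (2 * q) := by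
  have hset : MeasurableSet {x : ℝ | ε < |u * x|} := measurableSet_lt (by fun_prop) (by fun_prop)
  have h1 := map_measureReal_apply (μ := P) (hX.measurable_residual (R := R) ![s, t] ![1, -1]) hset
  rw [hX.map_residual_eq hcov hR0.ne' heven] at h1
  refine h1.symm.le.trans ((gaussianReal_real_lt_abs_mul_le _ u q hε).trans ?_)
  have hm : 0 ≤ ∫ x, x ^ (2 * q) ∂(gaussianReal 0 1) :=
    integral_nonneg fun x => (even_two_mul q).pow_nonneg x
  refine div_le_div_of_nonneg_right (mul_le_mul_of_nonneg_right
    (pow_le_pow_left₀ (by positivity) ?_ q) hm) (by positivity)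
  rw [Real.coe_toNNReal', residual_variance_eq_sub hR0.ne']
  simp only [Fin.sum_univ_two, Matrix.cons_val_zero, Matrix.cons_val_one, sub_self]
  rw [← neg_sub s t, heven, mul_max_of_nonneg _ _ (sq_nonneg u)]
  refine max_le ?_ (by simpa using ha0)
  have h2 : 0 ≤ u ^ 2 * ((1 * (R 0 - R s) + -1 * (R 0 - R t)) ^ 2 / R 0) := by positivity
  nlinarith

lemma integrable_cond_excess_pow [IsFiniteMeasure P] (hX : IsZeroMeanGaussianProcess P X) (u : ℝ)
    (p : ℕ) {s : Set Ω} (hs : P s ≠ 0) :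
    Integrable (fun ω => |1 + u * (X 0 ω - u)| ^ p) (P[|s]) := by
  have h0 : MemLp (X 0) (p : ENNReal) P := by
    rw [← ENNReal.coe_natCast]
    exact hX.memLp 0 p
  have h1 : MemLp (fun ω => X 0 ω - u) (p : ENNReal) P := h0.sub (memLp_const u)
  have h2 : MemLp (fun ω => 1 + u * (X 0 ω - u)) (p : ENNReal) P :=
    (memLp_const (1 : ℝ)).add (h1.const_mul u)
  have h4 : Integrable (fun ω => |1 + u * (X 0 ω - u)| ^ p) P := h2.integrable_norm_pow'
  rw [ProbabilityTheory.cond]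
  exact Integrable.smul_measure h4.restrict (ENNReal.inv_ne_top.2 hs)

lemma measureReal_cond_regression_increment_le [IsProbabilityMeasure P]
    (hX : IsZeroMeanGaussianProcess P X) (hR0 : 0 < R 0)
    (hsq : ∀ a b, (R a - R b) ^ 2 ≤ (R 0 - R (a + b)) * (R 0 - R (a - b)))
    {s t u a D M ε : ℝ} (hε : 0 < ε) (hA : P (X 0 ⁻¹' Ioi u) ≠ 0)
    (ha : u ^ 2 * (R 0 - R (s - t)) ≤ a) (ha0 : 0 ≤ u ^ 2 * (R 0 - R (s - t)))
    (hD : u ^ 2 * (R 0 - R (s + t)) ≤ D) (hD0 : 0 ≤ D) (q : ℕ)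
    (hM : ∫ ω, (1 + u * (X 0 ω - u)) ^ (2 * q) ∂(P[|X 0 ⁻¹' Ioi u]) ≤ M) :
    (P[|X 0 ⁻¹' Ioi u]).real
        {ω | ε < |u ^ 2 * |R s / R 0 - R t / R 0| * (1 + u * (X 0 ω - u))|}
      ≤ (D * a / R 0 ^ 2) ^ q * M / ε ^ (2 * q) := by
  have hinteg : Integrable (fun ω => (u ^ 2 * |R s / R 0 - R t / R 0| * (1 + u * (X 0 ω - u)))
      ^ (2 * q)) (P[|X 0 ⁻¹' Ioi u]) := by
    have := hX.integrable_cond_excess_pow u (2 * q) hA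
    simp only [(even_two_mul q).pow_abs] at this
    simp_rw [mul_pow _ _ (2 * q)]
    exact this.const_mul _
  have : IsProbabilityMeasure (P[|X 0 ⁻¹' Ioi u]) := cond_isProbabilityMeasure hA
  refine (measureReal_lt_abs_le_integral_pow hinteg hε).trans ?_
  set κ : ℝ := u ^ 2 * |R s / R 0 - R t / R 0| with hκ
  simp_rw [mul_pow _ _ (2 * q)]
  rw [integral_const_mul]
  have hκ2 : κ ^ 2 ≤ D * a / R 0 ^ 2 := by
    have e : κ ^ 2 = u ^ 2 * u ^ 2 * (R s - R t) ^ 2 / R 0 ^ 2 := by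
      rw [hκ, mul_pow, sq_abs]; field_simp
    rw [e]
    refine div_le_div_of_nonneg_right ?_ (by positivity)
    calc u ^ 2 * u ^ 2 * (R s - R t) ^ 2
        ≤ u ^ 2 * u ^ 2 * ((R 0 - R (s + t)) * (R 0 - R (s - t))) :=
          mul_le_mul_of_nonneg_left (hsq s t) (by positivity)
      _ = (u ^ 2 * (R 0 - R (s + t))) * (u ^ 2 * (R 0 - R (s - t))) := by ring
      _ ≤ D * a := mul_le_mul hD ha ha0 hD0
  have hκq : κ ^ (2 * q) ≤ (D * a / R 0 ^ 2) ^ q := by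
    rw [pow_mul]; exact pow_le_pow_left₀ (sq_nonneg _) hκ2 q
  refine div_le_div_of_nonneg_right ?_ (by positivity)
  exact mul_le_mul hκq hM (integral_nonneg fun ω => (even_two_mul q).pow_nonneg _)
    (((even_two_mul q).pow_nonneg κ).trans hκq)

lemma measureReal_cond_increment_le [IsProbabilityMeasure P] (hX : IsZeroMeanGaussianProcess P X)
    (hcov : ∀ s t, ∫ ω, X s ω * X t ω ∂P = R (s - t)) (hR0 : 0 < R 0)
    (heven : ∀ t, R (-t) = R t)
    (hsq : ∀ a b, (R a - R b) ^ 2 ≤ (R 0 - R (a + b)) * (R 0 - R (a - b)))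
    {s t u a D M ε : ℝ} (hε : 0 < ε) (hu : 1 ≤ u)
    (ha : u ^ 2 * (R 0 - R (s - t)) ≤ a) (ha0 : 0 ≤ u ^ 2 * (R 0 - R (s - t)))
    (hD : u ^ 2 * (R 0 - R (s + t)) ≤ D) (hD0 : 0 ≤ D) (q : ℕ)
    (hM : ∫ ω, (1 + u * (X 0 ω - u)) ^ (2 * q) ∂(P[|X 0 ⁻¹' Ioi u]) ≤ M) :
    (P[|X 0 ⁻¹' Ioi u]).real {ω | ε < |u * (X s ω - u) - u * (X t ω - u)|}
      ≤ (4 ^ q * (2 ^ q * (∫ x, x ^ (2 * q) ∂(gaussianReal 0 1)) + (D / R 0 ^ 2) ^ q * M))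
        * (a ^ q / ε ^ (2 * q)) := by
  have hlaw : P.map (X 0) = gaussianReal 0 (R 0).toNNReal := by
    simpa using hX.map_sum_eq hcov (ι := Unit) (fun _ => 0) (fun _ => 1)
  have hA : P (X 0 ⁻¹' Ioi u) ≠ 0 :=
    measure_gaussian_Ioi_ne_zero (by simpa using hR0) (hX.1 0) hlaw u
  have : IsProbabilityMeasure (P[|X 0 ⁻¹' Ioi u]) := cond_isProbabilityMeasure hA
  have hM0 : 0 ≤ M := le_trans (integral_nonneg fun ω => (even_two_mul q).pow_nonneg _) hM
  set κ : ℝ := u ^ 2 * |R s / R 0 - R t / R 0| with hκ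
  set L : Ω → ℝ := fun ω => ∑ i : Fin 2, ![1, -1] i *
        (X (![s, t] i) ω - R (![s, t] i) / R 0 * X 0 ω) with hL
  set S₁ := {ω | ε / 2 < |u * L ω|}
  set S₂ := {ω | ε / 2 < |κ * (1 + u * (X 0 ω - u))|}
  have hsub : (P[|X 0 ⁻¹' Ioi u]).real {ω | ε < |u * (X s ω - u) - u * (X t ω - u)|}
      ≤ (P[|X 0 ⁻¹' Ioi u]).real S₁ + (P[|X 0 ⁻¹' Ioi u]).real S₂ := by
    refine le_trans ?_ (measureReal_union_le _ _)
    refine ENNReal.toReal_mono (measure_ne_top _ _) (measure_mono_ae ?_)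
    filter_upwards [ae_cond_mem ((hX.1 0) measurableSet_Ioi)] with ω hω hlt
    have hω : u < X 0 ω := hω
    by_contra hcon
    have h1 : |u * L ω| ≤ ε / 2 := not_lt.1 fun h => hcon (Or.inl h)
    have h2 : |κ * (1 + u * (X 0 ω - u))| ≤ ε / 2 := not_lt.1 fun h => hcon (Or.inr h)
    have hlt : ε < |u * (X s ω - u) - u * (X t ω - u)| := hlt
    have heq : u * (X s ω - u) - u * (X t ω - u)
        = u * L ω + (R s / R 0 - R t / R 0) * (u * X 0 ω) := by
      simp only [hL, Fin.sum_univ_two, Matrix.cons_val_zero, Matrix.cons_val_one]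
      ring
    have h3 : |(R s / R 0 - R t / R 0) * (u * X 0 ω)| ≤ |κ * (1 + u * (X 0 ω - u))| := by
      have hV : 0 ≤ u * (X 0 ω - u) := by nlinarith
      rw [abs_mul, abs_mul κ, abs_of_nonneg (show 0 ≤ κ by positivity),
        abs_of_nonneg (show 0 ≤ u * X 0 ω by nlinarith),
        abs_of_nonneg (show 0 ≤ 1 + u * (X 0 ω - u) by linarith), hκ, mul_comm (u ^ 2), mul_assoc]
      refine mul_le_mul_of_nonneg_left ?_ (abs_nonneg _)
      nlinarith [mul_nonneg (show 0 ≤ u ^ 2 - 1 by nlinarith) hV]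
    rw [heq] at hlt
    linarith [abs_add_le (u * L ω) ((R s / R 0 - R t / R 0) * (u * X 0 ω))]
  have hS₁ : (P[|X 0 ⁻¹' Ioi u]).real S₁
      ≤ (2 * a) ^ q * (∫ x, x ^ (2 * q) ∂(gaussianReal 0 1)) / (ε / 2) ^ (2 * q) := by
    have := cond_preimage_of_indepFun (hX.indepFun_residual hcov hR0.ne' ![s, t] ![1, -1])
      (hX.1 0) (measurableSet_Ioi (a := u)) hA (E := {x | ε / 2 < |u * x|})
      (measurableSet_lt (by fun_prop) (by fun_prop))
    refine le_trans (le_of_eq ?_) (hX.measureReal_residual_increment_le hcov hR0 heven s t u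
      (half_pos hε) ha (ha0.trans ha) q)
    exact congrArg ENNReal.toReal this
  have hS₂ : (P[|X 0 ⁻¹' Ioi u]).real S₂ ≤ (D * a / R 0 ^ 2) ^ q * M / (ε / 2) ^ (2 * q) :=
    hX.measureReal_cond_regression_increment_le hR0 hsq (half_pos hε) hA ha ha0 hD hD0 q hM
  refine hsub.trans ((add_le_add hS₁ hS₂).trans_eq ?_)
  have e4 : (ε / 2) ^ (2 * q) = ε ^ (2 * q) / 4 ^ q := by
    rw [div_pow, pow_mul 2]; norm_num
  rw [e4, mul_pow, div_pow, div_pow, mul_pow]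
  field_simp

lemma exists_eventually_integral_cond_excess_pow_le [IsProbabilityMeasure P]
    (hX : IsZeroMeanGaussianProcess P X)
    (hcov : ∀ s t, ∫ ω, X s ω * X t ω ∂P = R (s - t)) (hR0 : 0 < R 0)
    {u : ℕ → ℝ} (hu : Tendsto u atTop atTop) (p : ℕ) :
    ∃ M, ∀ᶠ n in atTop,
      ∫ ω, (1 + u n * (X 0 ω - u n)) ^ p ∂(P[|X 0 ⁻¹' Ioi (u n)]) ≤ M := by
  have hlaw : P.map (X 0) = gaussianReal 0 (R 0).toNNReal := by
    simpa using hX.map_sum_eq hcov (ι := Unit) (fun _ => 0) (fun _ => 1)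
  have := tendsto_integral_cond_gaussian_excess (by simpa using hR0) (hX.1 0) hlaw hu
    (g := fun _ y => (1 + y) ^ p) (g₀ := fun y => (1 + y) ^ p) (G := fun y => (1 + y) ^ p)
    (fun _ => Measurable.stronglyMeasurable (by fun_prop))
    (fun _ y hy => by rw [Real.norm_of_nonneg (by positivity)])
    (by
      rw [Real.coe_toNNReal _ hR0.le]
      exact integrableOn_exp_neg_div_mul_one_add_pow hR0 p)
    (fun _ _ => tendsto_const_nhds)
  exact ⟨_, (this.eventually_lt_const (lt_add_one _)).mono fun n hn => hn.le⟩

lemma exists_measureReal_cond_dyadic_increment_le [IsProbabilityMeasure P]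
    (hX : IsZeroMeanGaussianProcess P X)
    (hcov : ∀ s t, ∫ ω, X s ω * X t ω ∂P = R (s - t)) (hR0 : 0 < R 0)
    (heven : ∀ t, R (-t) = R t) (hnonneg : ∀ t, 0 ≤ R 0 - R t)
    (hsq : ∀ a b, (R a - R b) ^ 2 ≤ (R 0 - R (a + b)) * (R 0 - R (a - b)))
    {u δ : ℕ → ℝ} (hu : Tendsto u atTop atTop)
    (hbd : ∀ K > 0, ∃ D > 0, ∀ᶠ n in atTop, ∀ t, |t| ≤ K → u n ^ 2 * (R 0 - R (t * δ n)) ≤ D)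
    (hdyadic : ∃ θ > 0, θ < 1 ∧ ∃ D > 0, ∀ᶠ n in atTop, ∀ m : ℕ,
      u n ^ 2 * (R 0 - R (1 / 2 ^ m * δ n)) ≤ D * θ ^ m) (K : ℕ) :
    ∃ b > 0, b < 1 ∧ ∃ r ≥ 0, r < 1 / 2 ∧ ∃ C ≥ 0, ∀ᶠ n in atTop,
      ∀ (m : ℕ) (k : ℤ), |k| ≤ K * 2 ^ m →
        (P[|X 0 ⁻¹' Ioi (u n)]).real {ω | b ^ m <
          |u n * (X ((k + 1) / 2 ^ m * δ n) ω - u n) - u n * (X (k / 2 ^ m * δ n) ω - u n)|}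
          ≤ C * r ^ m := by
  obtain ⟨θ, hθ0, hθ1, D', hD'0, hD'⟩ := hdyadic
  obtain ⟨D, hD0, hD⟩ := hbd (2 * K + 1) (by positivity)
  set b := √√θ with hb
  have hb0 : 0 < b := by positivity
  have hb4 : θ = b ^ 4 := by
    rw [show (4 : ℕ) = 2 * 2 from rfl, pow_mul, hb, Real.sq_sqrt (by positivity),
      Real.sq_sqrt hθ0.le]
  have hb1 : b < 1 := by
    by_contra hcon
    exact absurd (hb4 ▸ hθ1) (not_lt.2 (one_le_pow₀ (not_lt.1 hcon)))
  obtain ⟨q, hq⟩ := exists_pow_lt_of_lt_one (show (0 : ℝ) < 1 / 2 by norm_num)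
    (show b ^ 2 < 1 from pow_lt_one₀ hb0.le hb1 two_ne_zero)
  obtain ⟨M, hM⟩ := hX.exists_eventually_integral_cond_excess_pow_le hcov hR0 hu (2 * q)
  set C := 4 ^ q * (2 ^ q * (∫ x, x ^ (2 * q) ∂(gaussianReal 0 1)) + (D / R 0 ^ 2) ^ q * M) * D' ^ q
  refine ⟨b, hb0, hb1, (b ^ 2) ^ q, by positivity, hq, max C 0, le_max_right _ _, ?_⟩
  filter_upwards [hu.eventually_ge_atTop 1, hD, hD', hM] with n hun hDn hDn' hMn m k hk
  have hst : (k + 1) / 2 ^ m * δ n - k / 2 ^ m * δ n = 1 / 2 ^ m * δ n := by ring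
  have hst' : ((k : ℝ) + 1) / 2 ^ m * δ n + k / 2 ^ m * δ n = (2 * k + 1) / 2 ^ m * δ n := by ring
  have hkR : |(2 * (k : ℝ) + 1) / 2 ^ m| ≤ 2 * K + 1 := by
    have hk' : |(k : ℝ)| ≤ K * 2 ^ m := by exact_mod_cast hk
    rw [abs_div, abs_of_pos (by positivity : (0 : ℝ) < 2 ^ m), div_le_iff₀ (by positivity)]
    have h1 : (1 : ℝ) ≤ 2 ^ m := one_le_pow₀ one_le_two
    calc |2 * (k : ℝ) + 1| ≤ |2 * (k : ℝ)| + |1| := abs_add_le _ _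
      _ = 2 * |(k : ℝ)| + 1 := by rw [abs_mul, abs_two, abs_one]
      _ ≤ _ := by linarith
  refine (hX.measureReal_cond_increment_le hcov hR0 heven hsq (D := D) (a := D' * θ ^ m) (M := M)
    (pow_pos hb0 m) hun ?_ ?_ ?_ hD0.le q hMn).trans ?_
  · rw [hst]; exact hDn' m
  · exact mul_nonneg (sq_nonneg _) (hnonneg _)
  · rw [hst']; exact hDn _ hkR
  · have e : (D' * θ ^ m) ^ q / (b ^ m) ^ (2 * q) = D' ^ q * ((b ^ 2) ^ q) ^ m := by
      rw [hb4, mul_pow, mul_div_assoc]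
      congr 1
      rw [div_eq_iff (by positivity)]
      simp only [← pow_mul, ← pow_add]
      congr 1
      ring
    rw [e, ← mul_assoc]
    exact mul_le_mul_of_nonneg_right (le_max_left _ _) (by positivity)

/-- Conditionally on a high level being exceeded at time `0`, the rescaled excess process converges
weakly as soon as the rescaled incremental variance converges to a power function with suitable
uniform bounds. -/
theorem tendsto_integral_cond_excess [IsProbabilityMeasure P] (hX : IsZeroMeanGaussianProcess P X)
    (hcont : ∀ ω, Continuous fun t => X t ω)
    (hcov : ∀ s t, ∫ ω, X s ω * X t ω ∂P = R (s - t)) (hR0 : 0 < R 0)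
    (heven : ∀ t, R (-t) = R t) (hnonneg : ∀ t, 0 ≤ R 0 - R t)
    (hsq : ∀ a b, (R a - R b) ^ 2 ≤ (R 0 - R (a + b)) * (R 0 - R (a - b)))
    {u δ : ℕ → ℝ} (hu : Tendsto u atTop atTop) {C α : ℝ} (hC : 0 ≤ C) (hα : 0 < α)
    (hlim : ∀ t, Tendsto (fun n => u n ^ 2 * (R 0 - R (t * δ n))) atTop (nhds (C * |t| ^ α)))
    (hbd : ∀ K > 0, ∃ D > 0, ∀ᶠ n in atTop, ∀ t, |t| ≤ K → u n ^ 2 * (R 0 - R (t * δ n)) ≤ D)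
    (hdyadic : ∃ θ > 0, θ < 1 ∧ ∃ D > 0, ∀ᶠ n in atTop, ∀ m : ℕ,
      u n ^ 2 * (R 0 - R (1 / 2 ^ m * δ n)) ≤ D * θ ^ m)
    {Ω' : Type*} [MeasurableSpace Ω'] {Q : Measure Ω'} [IsProbabilityMeasure Q]
    {B : ℝ → Ω' → ℝ} {T : Ω' → ℝ} (hB : IsZeroMeanGaussianProcess Q B)
    (hB_cont : ∀ ω, Continuous fun t => B t ω)
    (hB_cov : ∀ s t : ℝ, ∫ ω, B s ω * B t ω ∂Q = (|t| ^ α + |s| ^ α - |t - s| ^ α) / 2)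
    (hT : Measurable T) (hexp : ∀ x : ℝ, 0 ≤ x → Q {ω | x < T ω} = ENNReal.ofReal (exp (-x)))
    (hind : ∀ (n : ℕ) (t : Fin n → ℝ), IndepFun (fun ω i => B (t i) ω) T Q)
    (F : BoundedContinuousFunction C(ℝ, ℝ) ℝ) :
    Tendsto (fun n => ∫ ω, F (ContinuousMap.mk (fun t : ℝ => u n * (X (t * δ n) ω - u n))
        (continuous_const.mul
          (((hcont ω).comp (continuous_mul_const (δ n))).sub continuous_const)))
        ∂(P[|X 0 ⁻¹' Ioi (u n)])) atTop
      (nhds (∫ ω, F (ContinuousMap.mk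
        (fun t : ℝ => √(2 * C) * B t ω + R 0 * T ω - C / R 0 * |t| ^ α)
        (((continuous_const.mul (hB_cont ω)).add continuous_const).sub
          (continuous_const.mul
            (continuous_abs.rpow_const fun _ => Or.inr hα.le)))) ∂Q)) := by
  have hlaw : P.map (X 0) = gaussianReal 0 (R 0).toNNReal := by
    simpa using hX.map_sum_eq hcov (ι := Unit) (fun _ => 0) (fun _ => 1)
  have (n : ℕ) : IsProbabilityMeasure (P[|X 0 ⁻¹' Ioi (u n)]) :=
    cond_isProbabilityMeasure
      (measure_gaussian_Ioi_ne_zero (by simpa using hR0) (hX.1 0) hlaw (u n))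
  let Z : ℕ → Ω → C(ℝ, ℝ) := fun n ω =>
    ⟨fun t => u n * (X (t * δ n) ω - u n), continuous_const.mul
      (((hcont ω).comp (continuous_mul_const (δ n))).sub continuous_const)⟩
  let W : Ω' → C(ℝ, ℝ) := fun ω =>
    ⟨fun t => √(2 * C) * B t ω + R 0 * T ω - C / R 0 * |t| ^ α,
      ((continuous_const.mul (hB_cont ω)).add continuous_const).sub
        (continuous_const.mul (continuous_abs.rpow_const fun _ => Or.inr hα.le))⟩
  have hZ (n : ℕ) (t : ℝ) : Measurable fun ω => Z n ω t :=
    show Measurable fun ω => u n * (X (t * δ n) ω - u n) from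
      ((hX.1 _).sub_const _).const_mul _
  have hW (t : ℝ) : Measurable fun ω => W ω t :=
    show Measurable fun ω => √(2 * C) * B t ω + R 0 * T ω - C / R 0 * |t| ^ α from
      (((hB.1 t).const_mul _).add (hT.const_mul _)).sub_const _
  refine tendsto_integral_of_tendsto_charFun_of_increments (Z := Z) (W := W) hZ hW
    (fun ι _ t c => ?_)
    (hX.exists_measureReal_cond_dyadic_increment_le hcov hR0 heven hnonneg hsq hu hbd hdyadic) F
  have h := hX.tendsto_integral_cexp_excess hcov hR0 heven hu hlim t c
  rw [← integral_cexp_fractional_add_exponential hB hB_cov hT hexp hind hC hR0] at h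
  exact h

end IsZeroMeanGaussianProcess

/-- conditionally on `[X₀ > u]`, the process `(u (X_{tδ_u} - u) : t ∈ ℝ)`
converges weakly on `C(ℝ)` (compact-open topology, i.e. uniform convergence on compact
sets) to `Y_t = √(2C_α) B(t) + R(0) T* - (C_α/R(0)) |t|^α`, where `B` is a fractional
Brownian motion with Hurst index `α/2` and `T*` is a standard exponential random
variable independent of `B`. -/
theorem excursion_stmt14
    (α : ℝ) (hα0 : 0 < α) (hα2 : α < 2)
    (μ : Measure ℝ) [IsFiniteMeasure μ]
    (hμ_nonnull : μ Set.univ ≠ 0)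
    (hμ_symm : μ.map (fun x => -x) = μ)
    (hμ_tail_pos : ∀ x > (0 : ℝ), 0 < μ (Set.Ici x))
    (hμ_rv : ∀ c > (0 : ℝ),
      Tendsto (fun x : ℝ => (μ (Set.Ici (c * x))).toReal / (μ (Set.Ici x)).toReal)
        atTop (nhds (c ^ (-α))))
    (R : ℝ → ℝ)
    (hR : ∀ t : ℝ, (R t : ℂ) = ∫ x : ℝ, Complex.exp (Complex.I * t * x) ∂μ)
    {Ω : Type*} [MeasurableSpace Ω] (P : Measure Ω) [IsProbabilityMeasure P]
    (X : ℝ → Ω → ℝ)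
    (hX_gauss : IsZeroMeanGaussianProcess P X)
    (hX_cont : ∀ ω, Continuous fun t => X t ω)
    (hX_cov : ∀ s t : ℝ, ∫ ω, X s ω * X t ω ∂P = R (s - t))
    (h : ℝ → ℝ)
    (hh : ∀ y : ℝ, h y = sInf {x : ℝ | 0 ≤ x ∧ (μ (Set.Ici x)).toReal ≤ y})
    (δ : ℝ → ℝ)
    (hδ : ∀ u : ℝ, δ u = (h (u ^ (-2 : ℝ)))⁻¹)
    -- the limit objects: a fractional Brownian motion `B` with Hurst index `α/2` and an
    -- independent standard exponential random variable `T*`, on some probability space.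
    {Ω' : Type*} [MeasurableSpace Ω'] (Q : Measure Ω') [IsProbabilityMeasure Q]
    (B : ℝ → Ω' → ℝ) (T : Ω' → ℝ)
    (hB_gauss : IsZeroMeanGaussianProcess Q B)
    (hB_cont : ∀ ω, Continuous fun t => B t ω)
    (hB_cov : ∀ s t : ℝ, ∫ ω, B s ω * B t ω ∂Q
      = (|t| ^ α + |s| ^ α - |t - s| ^ α) / 2)
    (hT_meas : Measurable T)
    (hT_exp : ∀ x : ℝ, 0 ≤ x → Q {ω | x < T ω} = ENNReal.ofReal (Real.exp (-x)))
    (hBT_indep : ∀ (n : ℕ) (t : Fin n → ℝ),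
      IndepFun (fun ω i => B (t i) ω) T Q) :
    ∀ F : BoundedContinuousFunction C(ℝ, ℝ) ℝ,
      Tendsto (fun u : ℝ =>
          ∫ ω, F (ContinuousMap.mk (fun t : ℝ => u * (X (t * δ u) ω - u))
              (continuous_const.mul
                (((hX_cont ω).comp (continuous_mul_right (δ u))).sub continuous_const)))
            ∂(P[|{ω | u < X 0 ω}]))
        atTop
        (nhds (∫ ω, F (ContinuousMap.mk
            (fun t : ℝ =>
              Real.sqrt (2 * (Real.pi / (Real.Gamma α * Real.sin (Real.pi * α / 2))))
                  * B t ω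
                + R 0 * T ω
                - Real.pi / (Real.Gamma α * Real.sin (Real.pi * α / 2)) / R 0 * |t| ^ α)
            (((continuous_const.mul (hB_cont ω)).add continuous_const).sub
              (continuous_const.mul
                (continuous_abs.rpow_const fun _ => Or.inr hα0.le)))) ∂Q)) := by
  intro F
  have hRcos := eq_integral_cos_of_fourier hR
  have hpos : ∀ x > (0 : ℝ), 0 < μ.real (Set.Ici x) := fun x hx =>
    ENNReal.toReal_pos (hμ_tail_pos x hx).ne' (measure_ne_top _ _)
  have heven := even_of_eq_integral_cos hRcos
  have hHG := tendsto_sub_div_measureReal_Ici hα0 hα2 hμ_symm hpos hμ_rv hRcos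
  have hC : 0 < Real.pi / (Real.Gamma α * Real.sin (Real.pi * α / 2)) := by
    have h1 := Real.Gamma_pos_of_pos hα0
    have h2 : 0 < Real.sin (Real.pi * α / 2) :=
      Real.sin_pos_of_pos_of_lt_pi (by positivity) (by nlinarith [Real.pi_pos])
    positivity
  have hk : ∀ u : ℝ, h (u ^ (-2 : ℝ))
      = sInf {x : ℝ | 0 ≤ x ∧ μ.real (Set.Ici x) ≤ u ^ (-2 : ℝ)} := fun u => hh _
  have hanti := antitone_measureReal_Ici (μ := μ)
  have hG0 := tendsto_measureReal_Ici_atTop (μ := μ)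
  have hkt := tendsto_sInf_le_rpow_neg_two hanti hpos hG0 hk
  have hGk : ∀ c > (0 : ℝ), _ := fun c hc => tendsto_sq_mul_comp_sInf hanti hpos hG0 hμ_rv hk hc
  have hH0 : R 0 - R 0 = 0 := sub_self _
  have hHeven : ∀ t, R 0 - R (-t) = R 0 - R t := fun t => by rw [heven]
  have hlim := fun t : ℝ => tendsto_sq_mul_comp_mul_inv (H := fun t => R 0 - R t)
    hH0 hHeven hα0 hpos hHG hkt hGk t
  have hbd : ∀ K > (0 : ℝ), _ := fun K hK => exists_forall_sq_mul_comp_mul_inv_le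
    (H := fun t => R 0 - R t) hH0 hHeven hanti hpos hC.le hHG hkt hGk hK
  obtain ⟨θ, hθ0, hθ1, D, hD0, hD⟩ := exists_forall_sq_mul_comp_inv_div_two_pow_le
    (H := fun t => R 0 - R t) hα0 hpos hC hμ_rv hHG hkt (hbd 1 one_pos)
  simp only [← hδ] at hlim hbd hD
  refine tendsto_of_seq_tendsto fun u hu => ?_
  exact hX_gauss.tendsto_integral_cond_excess hX_cont hX_cov
    (zero_pos_of_eq_integral_cos hμ_nonnull hRcos) heven (sub_nonneg_of_eq_integral_cos hRcos)
    (sq_sub_le_mul_of_eq_integral_cos hRcos) (δ := fun n => δ (u n)) hu hC.le hα0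
    (fun t => (hlim t).comp hu)
    (fun K hK => (hbd K hK).imp fun D hD => ⟨hD.1, hu.eventually hD.2⟩)
    ⟨θ, hθ0, hθ1, D, hD0, hu.eventually hD⟩
    hB_gauss hB_cont hB_cov hT_meas hT_exp hBT_indep F
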